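/- For every ε > 0 there exist N ∈ ℕ, δ > 0 and C ≥ 1 such that the following holds for every field K and all distinct projective planes P₁, P₂ ⊆ ℙ³(K). Suppose X₁ ⊆ P₁, X₂ ⊆ P₂ and X₃ ⊆ ℙ³(K)∖(P₁∪P₂) are finite sets with: (1) |X₁| = |X₂| = |X₃| ≥ C; (2) |X₁| < p^{1/N} if char K = p > 0; (3) |X₃ ∩ P| ≤ |X₃|^{1−ε} for every projective plane P ⊆ ℙ³(K) that intersects P₁ and P₂ in a common line; (4) |Xᵢ ∩ ℓ| ≤ |Xᵢ|^{1−ε} for every projective line ℓ ⊆ ℙ³(K) and each i = 1, 2, 3. Then |{(x₁,x₂,x₃) ∈ X₁×X₂×X₃ : x₁, x₂, x₃ are distinct and collinear}| ≤ |X₁|^{2−δ}. -/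

import Mathlib

open Module

universe u

/-- Three points of `ℙ³(K)` are collinear when their representative vectors lie in a common
2-dimensional linear subspace of `K⁴`. -/
def Coll3 {K : Type u} [Field K] (x y z : Projectivization K (Fin 4 → K)) : Prop :=
  finrank K ↥(x.submodule ⊔ y.submodule ⊔ z.submodule) ≤ 2

set_option maxHeartbeats 1000000 in
open Classical in
/-- A dense symmetric relation has a large set of elements any two of which are joined by many
paths of length four. -/
theorem exists_well_connected {α : Type*} [Fintype α] (r : α → α → Prop)
    (hs : ∀ x y, r x y → r y x) (κ : ℝ) (hκ : 1 ≤ κ) (hN : 0 < Fintype.card α)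
    (h : (Fintype.card α : ℝ) ^ 2 ≤ κ * (Finset.univ.filter fun p : α × α => r p.1 p.2).card) :
    ∃ A : Finset α, (Fintype.card α : ℝ) ≤ 4 * κ * A.card ∧ ∀ x ∈ A, ∀ y ∈ A,
      (Fintype.card α : ℝ) ^ 3 ≤ 2 ^ 12 * κ ^ 5 *
        (Finset.univ.filter fun t : α × α × α =>
          r x t.1 ∧ r t.1 t.2.1 ∧ r t.2.1 t.2.2 ∧ r t.2.2 y).card := by
  set N : ℝ := (Fintype.card α : ℝ) with hNdef
  have hN0 : 0 < N := Nat.cast_pos.2 hN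
  let nb : α → Finset α := fun z => Finset.univ.filter fun x => r x z
  let cod : α → α → ℝ := fun x y => ((Finset.univ.filter fun z => r x z ∧ r z y).card : ℝ)
  let bad : α → α → Prop := fun x y => 32 * κ ^ 2 * cod x y < N
  have hcod : ∀ x y, cod x y = cod y x := by
    intro x y
    simp only [cod]
    congr 2
    ext z
    simp only [Finset.mem_filter, Finset.mem_univ, true_and]
    exact ⟨fun h => ⟨hs _ _ h.2, hs _ _ h.1⟩, fun h => ⟨hs _ _ h.2, hs _ _ h.1⟩⟩
  have hbad : ∀ x y, bad x y → bad y x := by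
    intro x y h
    simp only [bad] at h ⊢
    rwa [hcod]
  let B : α → Finset (α × α) := fun z => (nb z ×ˢ nb z).filter fun p => bad p.1 p.2
  have h1 : ((Finset.univ.filter fun p : α × α => r p.1 p.2).card : ℝ) =
      ∑ z, ((nb z).card : ℝ) := by
    rw [Finset.card_filter, ← Finset.univ_product_univ, Finset.sum_product_right]
    push_cast
    refine Finset.sum_congr rfl fun z _ => ?_
    simp [nb]
  have h2 : (∑ z, ((nb z).card : ℝ)) ^ 2 ≤ N * ∑ z, ((nb z).card : ℝ) ^ 2 := by
    have := sq_sum_le_card_mul_sum_sq (s := (Finset.univ : Finset α))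
      (f := fun z => ((nb z).card : ℝ))
    simpa [hNdef] using this
  have h3 : 32 * κ ^ 2 * ∑ z, ((B z).card : ℝ) ≤ N ^ 3 := by
    have e : ∑ z, ((B z).card : ℝ) =
        ∑ p ∈ (Finset.univ : Finset (α × α)).filter (fun p => bad p.1 p.2), cod p.1 p.2 := by
      have e1 : ∀ z, ((B z).card : ℝ) =
          ∑ p ∈ (Finset.univ : Finset (α × α)).filter (fun p => bad p.1 p.2),
            if (r p.1 z ∧ r z p.2) then (1 : ℝ) else 0 := by
        intro z
        rw [← Finset.sum_filter, Finset.sum_const, nsmul_eq_mul, mul_one]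
        congr 2
        ext p
        simp only [B, nb, Finset.mem_filter, Finset.mem_product, Finset.mem_univ, true_and]
        exact ⟨fun h => ⟨h.2, h.1.1, hs _ _ h.1.2⟩, fun h => ⟨⟨h.2.1, hs _ _ h.2.2⟩, h.1⟩⟩
      simp_rw [e1]
      rw [Finset.sum_comm]
      refine Finset.sum_congr rfl fun p _ => ?_
      simp [cod]
    rw [e, Finset.mul_sum]
    calc _ ≤ ∑ p ∈ (Finset.univ : Finset (α × α)).filter (fun p => bad p.1 p.2), N := by
          refine Finset.sum_le_sum fun p hp => ?_
          exact le_of_lt (Finset.mem_filter.1 hp).2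
      _ ≤ ∑ p : α × α, N := Finset.sum_le_sum_of_subset_of_nonneg (Finset.filter_subset _ _)
          (fun _ _ _ => hN0.le)
      _ = N ^ 3 := by simp [hNdef]; ring
  have h4 : ∃ z, N ^ 2 / (2 * κ ^ 2) ≤ ((nb z).card : ℝ) ^ 2 - 16 * (B z).card := by
    by_contra hcon
    push Not at hcon
    have : ∑ z : α, (((nb z).card : ℝ) ^ 2 - 16 * (B z).card) < ∑ z : α, N ^ 2 / (2 * κ ^ 2) := by
      apply Finset.sum_lt_sum_of_nonempty
      · exact Finset.univ_nonempty_iff.2 (Fintype.card_pos_iff.1 hN)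
      · exact fun z _ => hcon z
    rw [Finset.sum_sub_distrib, ← Finset.mul_sum, Finset.sum_const, nsmul_eq_mul, Finset.card_univ,
      ← hNdef] at this
    rw [h1] at h
    set T := ∑ z, ((nb z).card : ℝ)
    set T2 := ∑ z, ((nb z).card : ℝ) ^ 2
    set Bs := ∑ z, ((B z).card : ℝ)
    have hk0 : 0 < κ ^ 2 := by positivity
    have a1 : N ^ 3 ≤ κ ^ 2 * T2 := by
      have : (N ^ 2) ^ 2 ≤ (κ * T) ^ 2 := pow_le_pow_left₀ (by positivity) h 2
      have : N * N ^ 3 ≤ N * (κ ^ 2 * T2) := by nlinarith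
      exact le_of_mul_le_mul_left this hN0
    have a2 : (T2 - 16 * Bs) * (2 * κ ^ 2) < N ^ 3 := by
      have := mul_lt_mul_of_pos_right this (show 0 < 2 * κ ^ 2 by positivity)
      rw [mul_assoc N, div_mul_cancel₀ _ (by positivity)] at this
      nlinarith
    nlinarith
  obtain ⟨z, hz⟩ := h4
  set A' := nb z
  set M : ℝ := (A'.card : ℝ) with hM
  have hM0 : 0 ≤ M := by positivity
  have hB0 : (0 : ℝ) ≤ (B z).card := by positivity
  have hMN : N ≤ 2 * κ * M := by
    have : N ^ 2 / (2 * κ ^ 2) ≤ M ^ 2 := by linarith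
    rw [div_le_iff₀ (by positivity)] at this
    refine abs_le_of_sq_le_sq' ?_ (by positivity) |>.2
    nlinarith [mul_nonneg (sq_nonneg M) (sq_nonneg κ)]
  have hMpos : 0 < M := by
    by_contra hc
    have : M = 0 := le_antisymm (not_lt.1 hc) hM0
    rw [this] at hMN
    linarith
  have hBM : 16 * ((B z).card : ℝ) ≤ M ^ 2 := by
    have : 0 ≤ N ^ 2 / (2 * κ ^ 2) := by positivity
    linarith
  let bd : α → Finset α := fun x => A'.filter fun y => bad x y
  let A := A'.filter fun x => 4 * ((bd x).card : ℝ) ≤ M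
  have hA : M ≤ 2 * A.card := by
    have e : ((B z).card : ℝ) = ∑ x ∈ A', ((bd x).card : ℝ) := by
      simp only [B, bd]
      rw [Finset.card_filter, Finset.sum_product]
      push_cast
      refine Finset.sum_congr rfl fun x _ => ?_
      simp [A']
    have e2 : M / 4 * (A'.filter fun x => ¬ 4 * ((bd x).card : ℝ) ≤ M).card ≤ (B z).card := by
      rw [e]
      calc _ = ∑ x ∈ A'.filter (fun x => ¬ 4 * ((bd x).card : ℝ) ≤ M), M / 4 := by
            rw [Finset.sum_const, nsmul_eq_mul, mul_comm]
        _ ≤ ∑ x ∈ A'.filter (fun x => ¬ 4 * ((bd x).card : ℝ) ≤ M), ((bd x).card : ℝ) := by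
            refine Finset.sum_le_sum fun x hx => ?_
            have := (Finset.mem_filter.1 hx).2
            linarith
        _ ≤ _ := Finset.sum_le_sum_of_subset_of_nonneg (Finset.filter_subset _ _)
          (fun _ _ _ => by positivity)
    have e3 : (A.card : ℝ) + (A'.filter fun x => ¬ 4 * ((bd x).card : ℝ) ≤ M).card = M := by
      have := Finset.card_filter_add_card_filter_not (s := A') (fun x => 4 * ((bd x).card : ℝ) ≤ M)
      have := congrArg (Nat.cast : ℕ → ℝ) this
      rw [Nat.cast_add] at this
      exact this
    nlinarith
  refine ⟨A, by nlinarith, ?_⟩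
  intro x hx y hy
  have hx' := (Finset.mem_filter.1 hx).2
  have hy' := (Finset.mem_filter.1 hy).2
  let Z := A'.filter fun z => ¬ bad x z ∧ ¬ bad y z
  have hZ : M ≤ 2 * Z.card := by
    have : A' ⊆ Z ∪ (bd x ∪ bd y) := by
      intro w hw
      simp only [Z, bd, Finset.mem_union, Finset.mem_filter]
      tauto
    have h5 := (Finset.card_le_card this).trans ((Finset.card_union_le _ _).trans
      (Nat.add_le_add_left (Finset.card_union_le _ _) _))
    have h6 : M ≤ Z.card + ((bd x).card + (bd y).card) := by
      have := (Nat.cast_le (α := ℝ)).2 h5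
      push_cast at this
      exact this
    linarith
  have key : ∑ z ∈ Z, cod x z * cod z y ≤ ((Finset.univ.filter fun t : α × α × α =>
          r x t.1 ∧ r t.1 t.2.1 ∧ r t.2.1 t.2.2 ∧ r t.2.2 y).card : ℝ) := by
    have : (Z.sigma fun z => (Finset.univ.filter fun a => r x a ∧ r a z) ×ˢ
        (Finset.univ.filter fun b => r z b ∧ r b y)).card ≤ (Finset.univ.filter fun t : α × α × α =>
          r x t.1 ∧ r t.1 t.2.1 ∧ r t.2.1 t.2.2 ∧ r t.2.2 y).card := by
      refine Finset.card_le_card_of_injOn (fun s => (s.2.1, s.1, s.2.2)) ?_ ?_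
      · rintro ⟨z, a, b⟩ h
        simp only [Finset.mem_coe, Finset.mem_sigma, Finset.mem_product,
          Finset.mem_filter, Finset.mem_univ, true_and] at h ⊢
        tauto
      · rintro ⟨z, a, b⟩ _ ⟨z', a', b'⟩ _ h
        simp only [Prod.mk.injEq] at h
        obtain ⟨rfl, rfl, rfl⟩ := h
        rfl
    rw [Finset.card_sigma] at this
    have := (Nat.cast_le (α := ℝ)).2 this
    simp only [Finset.card_product, Nat.cast_sum, Nat.cast_mul] at this
    exact this
  have low : ∀ z ∈ Z, N ^ 2 ≤ 2 ^ 10 * κ ^ 4 * (cod x z * cod z y) := by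
    intro z hz
    obtain ⟨_, b1, b2⟩ := Finset.mem_filter.1 hz
    simp only [bad, not_lt] at b1 b2
    rw [hcod y z] at b2
    have := mul_le_mul b1 b2 hN0.le (by positivity)
    nlinarith
  have : (Z.card : ℝ) * N ^ 2 ≤ 2 ^ 10 * κ ^ 4 * ∑ z ∈ Z, cod x z * cod z y := by
    rw [Finset.mul_sum, ← nsmul_eq_mul]
    exact Finset.card_nsmul_le_sum _ _ _ low
  calc N ^ 3 = N * N ^ 2 := by ring
    _ ≤ (4 * κ * Z.card) * N ^ 2 := by
      apply mul_le_mul_of_nonneg_right _ (by positivity)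
      nlinarith
    _ = 4 * κ * (Z.card * N ^ 2) := by ring
    _ ≤ 4 * κ * (2 ^ 10 * κ ^ 4 * ∑ z ∈ Z, cod x z * cod z y) := by gcongr
    _ = 2 ^ 12 * κ ^ 5 * ∑ z ∈ Z, cod x z * cod z y := by ring
    _ ≤ _ := by gcongr

open scoped Pointwise in
theorem exists_popular_quotients {G : Type*} [Group G] [DecidableEq G] (A : Finset G)
    (hA : A.Nonempty) (C : ℝ) (hC : 1 ≤ C) (h : ((A * A⁻¹).card : ℝ) ≤ C * A.card) :
    ∃ S : Finset G, S⁻¹ = S ∧ (A.card : ℝ) ≤ 2 * C * S.card ∧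
      ∀ T : Finset G, ((A * S * T).card : ℝ) ≤ 2 * C ^ 2 * (A * T).card := by
  set a : ℝ := (A.card : ℝ) with ha
  have ha0 : 0 < a := Nat.cast_pos.2 hA.card_pos
  let F : G → Finset (G × G) := fun s => (A⁻¹ ×ˢ A).filter fun p => p.1 * p.2 = s
  let rr : G → ℝ := fun s => ((F s).card : ℝ)
  let S := (A⁻¹ * A).filter fun s => a ≤ 2 * C * rr s
  have hrinv : ∀ s, rr s⁻¹ = rr s := by
    have hle : ∀ s, (F s).card ≤ (F s⁻¹).card := by
      intro s
      refine Finset.card_le_card_of_injOn (fun p => (p.2⁻¹, p.1⁻¹)) ?_ ?_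
      · rintro ⟨x, y⟩ hp
        simp only [F, Finset.mem_coe, Finset.mem_filter, Finset.mem_product,
          Finset.mem_inv'] at hp ⊢
        refine ⟨⟨by simpa using hp.1.2, hp.1.1⟩, ?_⟩
        rw [← hp.2, mul_inv_rev]
      · rintro ⟨x, y⟩ _ ⟨x', y'⟩ _ hxy
        simp only [Prod.mk.injEq, inv_inj] at hxy
        simp [hxy.1, hxy.2]
    intro s
    refine le_antisymm ?_ (Nat.cast_le.2 (hle s))
    have := hle s⁻¹
    rw [inv_inv] at this
    exact Nat.cast_le.2 this
  have hSinv : S⁻¹ = S := by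
    ext s
    simp only [S, Finset.mem_inv', Finset.mem_filter, hrinv]
    refine and_congr_left fun _ => ?_
    rw [← Finset.mem_inv']
    simp
  have hrle : ∀ s, rr s ≤ a := by
    intro s
    refine Nat.cast_le.2 (Finset.card_le_card_of_injOn (fun p => p.2) ?_ ?_)
    · rintro ⟨x, y⟩ hp
      simp only [F, Finset.mem_coe, Finset.mem_filter, Finset.mem_product] at hp ⊢
      exact hp.1.2
    · rintro ⟨x, y⟩ hp ⟨x', y'⟩ hp' hxy
      simp only [F, Finset.mem_coe, Finset.mem_filter] at hp hp' hxy
      subst hxy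
      have := hp.2.trans hp'.2.symm
      simpa using this
  have hsum : ∑ s ∈ A⁻¹ * A, rr s = a ^ 2 := by
    have := Finset.card_eq_sum_card_fiberwise (s := A⁻¹ ×ˢ A) (t := A⁻¹ * A)
      (f := fun p => p.1 * p.2) (fun p hp => by
        have := Finset.mem_product.1 hp
        exact Finset.mul_mem_mul this.1 this.2)
    have := congrArg (Nat.cast : ℕ → ℝ) this
    rw [Finset.card_product, Finset.card_inv, Nat.cast_mul, Nat.cast_sum] at this
    rw [← this]
    ring
  have hE : a ^ 3 ≤ C * ∑ s ∈ A⁻¹ * A, rr s ^ 2 := by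
    have e1 := Finset.le_card_mul_mul_mulEnergy A A⁻¹
    have e2 : Finset.mulEnergy A A⁻¹ ≤ Finset.mulEnergy A⁻¹ A := by
      unfold Finset.mulEnergy
      refine Finset.card_le_card_of_injOn
        (fun x => ((x.1.2⁻¹, x.2.2), (x.1.1, x.2.1⁻¹))) ?_ ?_
      · rintro ⟨⟨x1, x2⟩, y1, y2⟩ hp
        simp only [Finset.mem_coe, Finset.mem_filter, Finset.mem_product, Finset.mem_inv',
          inv_inv] at hp ⊢
        refine ⟨⟨⟨hp.1.1.2, hp.1.2.2⟩, hp.1.1.1, hp.1.2.1⟩, ?_⟩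
        have := hp.2
        rw [inv_mul_eq_iff_eq_mul, ← mul_assoc, ← this]
        group
      · rintro ⟨⟨x1, x2⟩, y1, y2⟩ _ ⟨⟨x1', x2'⟩, y1', y2'⟩ _ hxy
        simp only [Prod.mk.injEq, inv_inj] at hxy ⊢
        tauto
    rw [Finset.mulEnergy_eq_sum_sq' A⁻¹ A] at e2
    have e3 := (Nat.cast_le (α := ℝ)).2 (e1.trans (Nat.mul_le_mul_left _ e2))
    rw [Finset.card_inv] at e3
    push_cast at e3
    rw [← ha] at e3
    have e4 : a * a ^ 3 ≤ a * (C * ∑ s ∈ A⁻¹ * A, rr s ^ 2) := by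
      calc a * a ^ 3 = a ^ 2 * a ^ 2 := by ring
        _ ≤ _ := e3
        _ ≤ (C * a) * ∑ s ∈ A⁻¹ * A, rr s ^ 2 :=
          mul_le_mul_of_nonneg_right h (Finset.sum_nonneg fun _ _ => sq_nonneg _)
        _ = _ := by ring
    exact le_of_mul_le_mul_left e4 ha0
  have hScard : a ≤ 2 * C * S.card := by
    have s1 : ∑ s ∈ A⁻¹ * A, rr s ^ 2 ≤ ∑ s ∈ A⁻¹ * A, (a / (2 * C)) * rr s + ∑ s ∈ S, a ^ 2 := by
      rw [Finset.sum_filter, ← Finset.sum_add_distrib]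
      refine Finset.sum_le_sum fun s _ => ?_
      have r0 : 0 ≤ rr s := Nat.cast_nonneg _
      split_ifs with hs
      · have : 0 ≤ a / (2 * C) * rr s := by positivity
        nlinarith [hrle s]
      · rw [not_le] at hs
        have : rr s ≤ a / (2 * C) := by
          rw [le_div_iff₀ (by positivity)]
          linarith
        nlinarith
    rw [← Finset.mul_sum, hsum, Finset.sum_const, nsmul_eq_mul] at s1
    have : C * (a / (2 * C) * a ^ 2) = a ^ 3 / 2 := by
      field_simp
    have h5 : a ^ 2 * a ≤ a ^ 2 * (2 * C * S.card) := by nlinarith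
    exact le_of_mul_le_mul_left h5 (by positivity)
  refine ⟨S, hSinv, hScard, ?_⟩
  intro T
  have key : ((A * S * T).card : ℝ) * (a / (2 * C)) ≤ ((A * A⁻¹).card : ℝ) * (A * T).card := by
    have hfib : ∀ g ∈ A * S * T, a / (2 * C) ≤
        (((A * A⁻¹) ×ˢ (A * T)).filter fun p => p.1 * p.2 = g).card := by
      intro g hg
      obtain ⟨as, has, c, hc, rfl⟩ := Finset.mem_mul.1 hg
      obtain ⟨b, hb, s, hs, rfl⟩ := Finset.mem_mul.1 has
      have hs2 := (Finset.mem_filter.1 hs).2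
      have : rr s ≤ (((A * A⁻¹) ×ˢ (A * T)).filter fun p => p.1 * p.2 = b * s * c).card := by
        refine Nat.cast_le.2 (Finset.card_le_card_of_injOn (fun p => (b * p.1, p.2 * c)) ?_ ?_)
        · rintro ⟨x, y⟩ hp
          simp only [F, Finset.mem_coe, Finset.mem_filter, Finset.mem_product] at hp ⊢
          refine ⟨⟨Finset.mul_mem_mul hb hp.1.1, Finset.mul_mem_mul hp.1.2 hc⟩, ?_⟩
          rw [← hp.2]
          group
        · rintro ⟨x, y⟩ _ ⟨x', y'⟩ _ hxy
          simpa using hxy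
      refine le_trans ?_ this
      rw [div_le_iff₀ (by positivity)]
      linarith
    have c1 : ((A * S * T).card : ℝ) * (a / (2 * C)) ≤
        ∑ g ∈ A * S * T, ((((A * A⁻¹) ×ˢ (A * T)).filter fun p => p.1 * p.2 = g).card : ℝ) := by
      rw [← nsmul_eq_mul]
      exact Finset.card_nsmul_le_sum _ _ _ hfib
    refine c1.trans ?_
    rw [← Nat.cast_sum, ← Nat.cast_mul, ← Finset.card_product]
    refine Nat.cast_le.2 ?_
    rw [Finset.sum_card_fiberwise_eq_card_filter]
    exact Finset.card_filter_le _ _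
  have k2 : ((A * S * T).card : ℝ) * (a / (2 * C)) ≤ C * a * (A * T).card :=
    key.trans (mul_le_mul_of_nonneg_right h (Nat.cast_nonneg _))
  rw [mul_div_assoc', div_le_iff₀ (by positivity)] at k2
  have k3 : a * ((A * S * T).card : ℝ) ≤ a * (2 * C ^ 2 * (A * T).card) := by linarith
  exact le_of_mul_le_mul_left k3 ha0

open Classical in
/-- The number of pairs of indices at which `q` takes the same value. -/
noncomputable def collisions {ι G : Type*} [Fintype ι] (q : ι → G) : ℕ :=
  (Finset.univ.filter fun p : ι × ι => q p.1 = q p.2).card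

/-- The quotients `(q x)⁻¹ * q y`, indexed by pairs `(x, y)`. -/
def pairQuotient {ι G : Type*} [Group G] (q : ι → G) : ι × ι → G :=
  fun p => (q p.1)⁻¹ * q p.2

open Classical in
theorem collisions_eq_sum {ι G : Type*} [Fintype ι] (q : ι → G) :
    collisions q = ∑ x, (Finset.univ.filter fun y => q y = q x).card := by
  unfold collisions
  rw [Finset.card_filter, ← Finset.univ_product_univ, Finset.sum_product_right]
  exact Finset.sum_congr rfl fun x _ => (Finset.card_filter _ _).symm

open Classical in
theorem card_filter_eq_mul_le_collisions {ι G : Type*} [Fintype ι] [Group G] (q : ι → G) (h : G) :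
    (Finset.univ.filter fun p : ι × ι => q p.1 * (q p.2)⁻¹ = h).card ≤ collisions q := by
  let s : G → ℕ := fun g => (Finset.univ.filter fun y => q y = g).card
  have hcol : collisions q = ∑ g ∈ Finset.univ.image q, s g ^ 2 := by
    rw [collisions_eq_sum, Finset.sum_comp s q]
    exact Finset.sum_congr rfl fun g _ => by rw [sq]; rfl
  have hcard : (Finset.univ.filter fun p : ι × ι => q p.1 * (q p.2)⁻¹ = h).card =
      ∑ g ∈ Finset.univ.image q, s g * s (h * g) := by
    have : (Finset.univ.filter fun p : ι × ι => q p.1 * (q p.2)⁻¹ = h).card =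
        ∑ y, s (h * q y) := by
      rw [Finset.card_filter, ← Finset.univ_product_univ, Finset.sum_product_right]
      refine Finset.sum_congr rfl fun y _ => ?_
      simp only [s, Finset.card_filter]
      refine Finset.sum_congr rfl fun x _ => ?_
      simp only [mul_inv_eq_iff_eq_mul]
    rw [this, Finset.sum_comp (fun g => s (h * g)) q]
    exact Finset.sum_congr rfl fun g _ => by rfl
  have hshift : ∑ g ∈ Finset.univ.image q, s (h * g) ^ 2 ≤ ∑ g ∈ Finset.univ.image q, s g ^ 2 := by
    rw [← Finset.sum_image (s := Finset.univ.image q) (g := fun g => h * g)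
      (f := fun g => s g ^ 2) (fun x _ y _ hxy => mul_left_cancel hxy)]
    refine Finset.sum_le_sum_of_ne_zero fun g _ hg => ?_
    by_contra hc
    apply hg
    have : s g = 0 := by
      simp only [s, Finset.card_eq_zero, Finset.filter_eq_empty_iff, Finset.mem_univ, true_imp_iff]
      intro y hy
      exact hc (Finset.mem_image.2 ⟨y, Finset.mem_univ _, hy⟩)
    rw [this]
    rfl
  rw [hcard]
  have h2 : 2 * ∑ g ∈ Finset.univ.image q, s g * s (h * g) ≤
      ∑ g ∈ Finset.univ.image q, s g ^ 2 + ∑ g ∈ Finset.univ.image q, s (h * g) ^ 2 := by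
    rw [Finset.mul_sum, ← Finset.sum_add_distrib]
    refine Finset.sum_le_sum fun g _ => ?_
    rw [← mul_assoc]
    exact two_mul_le_add_sq _ _
  omega

open Classical in
theorem collisions_pairQuotient {ι G : Type*} [Fintype ι] [Group G] (q : ι → G) :
    collisions (pairQuotient q) ≤ ∑ p : ι × ι, (Finset.univ.filter fun p' : ι × ι =>
      q p'.1 * (q p'.2)⁻¹ = q p.1 * (q p.2)⁻¹).card := by
  have := collisions_eq_sum (fun p : ι × ι => q p.1 * (q p.2)⁻¹)
  rw [← this]
  unfold collisions
  refine Finset.card_le_card_of_injOn (fun x => ((x.2.1, x.1.1), (x.2.2, x.1.2))) ?_ ?_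
  · rintro ⟨⟨a, b⟩, c, d⟩ hx
    have hx' : (q a)⁻¹ * q b = (q c)⁻¹ * q d := (Finset.mem_filter.1 (Finset.mem_coe.1 hx)).2
    rw [inv_mul_eq_iff_eq_mul] at hx'
    refine Finset.mem_coe.2 (Finset.mem_filter.2 ⟨Finset.mem_univ _, ?_⟩)
    simp only [hx']
    group
  · rintro ⟨⟨a, b⟩, c, d⟩ _ ⟨⟨a', b'⟩, c', d'⟩ _ hx
    simp only [Prod.mk.injEq] at hx ⊢
    tauto

open Classical in
theorem sum_card_fiber_le {α β : Type*} (t : Finset β) (s : Finset α) (f : α → β) :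
    ∑ g ∈ t, (s.filter fun x => f x = g).card ≤ s.card := by
  rw [← Finset.card_biUnion]
  · exact Finset.card_le_card (Finset.biUnion_subset.2 fun g _ => Finset.filter_subset _ _)
  · intro a _ b _ hab
    refine Finset.disjoint_left.2 fun x h1 h2 => hab ?_
    rw [← (Finset.mem_filter.1 h1).2, (Finset.mem_filter.1 h2).2]

set_option maxHeartbeats 1000000 in
open Classical in
open scoped Pointwise in
theorem exists_small_quotients {ι G : Type*} [Fintype ι] [Group G] (q : ι → G)
    (hι : 0 < Fintype.card ι) (k : ℝ) (hk : 1 ≤ k)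
    (h : (Fintype.card ι : ℝ) ^ 2 * collisions q ≤ k * collisions (pairQuotient q)) :
    ∃ B : Finset ι, (Fintype.card ι : ℝ) ≤ 16 * k * B.card ∧
      (Fintype.card ι : ℝ) ^ 2 ≤ 2 ^ 7 * k ^ 2 * ((B.image q).card * collisions q) ∧
      ((B.image q * (B.image q)⁻¹).card : ℝ) * collisions q ≤
        2 ^ 35 * k ^ 12 * (Fintype.card ι : ℝ) ^ 2 := by
  set N : ℝ := (Fintype.card ι : ℝ) with hNdef
  have hN0 : 0 < N := Nat.cast_pos.2 hι
  set c : ℝ := (collisions q : ℝ) with hc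
  let R : ι × ι → ℕ := fun p => (Finset.univ.filter fun p' : ι × ι =>
      q p'.1 * (q p'.2)⁻¹ = q p.1 * (q p.2)⁻¹).card
  let s : ι → ℕ := fun x => (Finset.univ.filter fun y => q y = q x).card
  have hs1 : ∀ x, 1 ≤ s x := fun x => Finset.card_pos.2 ⟨x, by simp⟩
  have hcs : c = ∑ x, (s x : ℝ) := by rw [hc, collisions_eq_sum, Nat.cast_sum]
  have hc0 : 0 < c := by
    rw [hcs]
    exact Finset.sum_pos (fun x _ => Nat.cast_pos.2 (hs1 x))
      (Finset.univ_nonempty_iff.2 (Fintype.card_pos_iff.1 hι))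
  have hRc : ∀ p, (R p : ℝ) ≤ c := fun p => Nat.cast_le.2 (card_filter_eq_mul_le_collisions q _)
  have hRsum : N ^ 2 * c ≤ k * ∑ p, (R p : ℝ) := by
    refine h.trans (mul_le_mul_of_nonneg_left ?_ (by linarith))
    rw [← Nat.cast_sum]
    exact Nat.cast_le.2 (collisions_pairQuotient q)
  let E : Finset (ι × ι) := Finset.univ.filter fun p => c ≤ 2 * k * R p
  have hE : N ^ 2 ≤ 2 * k * E.card := by
    have e1 : ∑ p, (R p : ℝ) ≤ ∑ p : ι × ι, c / (2 * k) + ∑ p ∈ E, c := by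
      rw [Finset.sum_filter, ← Finset.sum_add_distrib]
      refine Finset.sum_le_sum fun p _ => ?_
      split_ifs with hp
      · have : 0 ≤ c / (2 * k) := by positivity
        linarith [hRc p]
      · rw [not_le] at hp
        rw [add_zero, le_div_iff₀ (by positivity)]
        linarith
    rw [Finset.sum_const, Finset.sum_const, nsmul_eq_mul, nsmul_eq_mul, Finset.card_univ,
      Fintype.card_prod, Nat.cast_mul, ← hNdef] at e1
    have e2 : k * (N * N * (c / (2 * k)) + E.card * c) = c * (N ^ 2 / 2 + k * E.card) := by
      field_simp
    have e3 : c * N ^ 2 ≤ c * (N ^ 2 / 2 + k * E.card) := by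
      rw [← e2]
      nlinarith
    linarith [le_of_mul_le_mul_left e3 hc0]
  obtain ⟨good, hgood⟩ : ∃ good : ι → Prop, ∀ x, good x ↔ s x * N ≤ 8 * k * c :=
    ⟨_, fun _ => Iff.rfl⟩
  have hbig : 8 * k * ((Finset.univ.filter fun x => ¬ good x).card : ℝ) ≤ N := by
    have : ((Finset.univ.filter fun x => ¬ good x).card : ℝ) * (8 * k * c) ≤ N * c := by
      rw [← nsmul_eq_mul]
      refine (Finset.card_nsmul_le_sum _ (fun x => (s x : ℝ) * N) _ fun x hx => ?_).trans ?_
      · exact le_of_lt (not_le.1 fun hh => (Finset.mem_filter.1 hx).2 ((hgood x).2 hh))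
      · rw [← Finset.sum_mul, mul_comm]
        refine mul_le_mul_of_nonneg_left ?_ hN0.le
        refine le_trans ?_ hcs.ge
        exact Finset.sum_le_sum_of_subset_of_nonneg (Finset.filter_subset _ _)
          fun _ _ _ => Nat.cast_nonneg _
    have : c * (8 * k * ((Finset.univ.filter fun x => ¬ good x).card : ℝ)) ≤ c * N := by linarith
    exact le_of_mul_le_mul_left this hc0
  obtain ⟨r, hrdef⟩ : ∃ r : ι → ι → Prop, ∀ x y, r x y ↔ (x, y) ∈ E ∧ good x ∧ good y :=
    ⟨_, fun _ _ => Iff.rfl⟩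
  have hr : ∀ x y, r x y → r y x := by
    intro x y hxy
    obtain ⟨h1, h2, h3⟩ := (hrdef x y).1 hxy
    refine (hrdef y x).2 ⟨?_, h3, h2⟩
    have : R (y, x) = R (x, y) := by
      refine Finset.card_equiv (Equiv.prodComm ι ι) ?_
      rintro ⟨a, b⟩
      simp only [Finset.mem_filter, Finset.mem_univ, true_and, Equiv.prodComm_apply, Prod.swap]
      rw [← inv_inj]
      simp
    simp only [E, Finset.mem_filter, Finset.mem_univ, true_and] at h1 ⊢
    rwa [this]
  have hedge : N ^ 2 ≤ 4 * k * (Finset.univ.filter fun p : ι × ι => r p.1 p.2).card := by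
    set bad := Finset.univ.filter fun x => ¬ good x
    have sub : E ⊆ (Finset.univ.filter fun p : ι × ι => r p.1 p.2) ∪
        (bad ×ˢ Finset.univ ∪ Finset.univ ×ˢ bad) := by
      rintro ⟨x, y⟩ hp
      simp only [bad, hrdef, Finset.mem_union, Finset.mem_filter, Finset.mem_product,
        Finset.mem_univ,
        true_and, and_true]
      tauto
    have h5 := (Finset.card_le_card sub).trans ((Finset.card_union_le _ _).trans
      (Nat.add_le_add_left (Finset.card_union_le _ _) _))
    have h6 := (Nat.cast_le (α := ℝ)).2 h5
    rw [Finset.card_product, Finset.card_product, Finset.card_univ] at h6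
    push_cast at h6
    rw [← hNdef] at h6
    nlinarith
  obtain ⟨B, hB1, hB2⟩ := exists_well_connected r hr (4 * k) (by linarith) hι hedge
  have hBne : B.Nonempty := by
    rw [Finset.nonempty_iff_ne_empty]
    rintro rfl
    simp at hB1
    linarith
  have hBgood : ∀ x ∈ B, good x := by
    intro x hx
    have := hB2 x hx x hx
    have hpos : (0 : ℝ) < N ^ 3 := by positivity
    have hne : (Finset.univ.filter fun t : ι × ι × ι =>
          r x t.1 ∧ r t.1 t.2.1 ∧ r t.2.1 t.2.2 ∧ r t.2.2 x).Nonempty := by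
      rw [Finset.nonempty_iff_ne_empty]
      intro h0
      have h00 := Finset.card_eq_zero.2 h0
      have : N ^ 3 ≤ 2 ^ 12 * (4 * k) ^ 5 * ((0 : ℕ) : ℝ) :=
        this.trans_eq (congrArg (fun n : ℕ => 2 ^ 12 * (4 * k) ^ 5 * (n : ℝ)) h00)
      rw [Nat.cast_zero, mul_zero] at this
      linarith
    obtain ⟨t, ht⟩ := hne
    exact ((hrdef _ _).1 (Finset.mem_filter.1 ht).2.1).2.1
  refine ⟨B, by linarith, ?_, ?_⟩
  · have e1 : (B.card : ℝ) * N ≤ (B.image q).card * (8 * k * c) := by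
      have : B.card = ∑ g ∈ B.image q, (B.filter fun x => q x = g).card :=
        Finset.card_eq_sum_card_image q B
      rw [this, Nat.cast_sum, Finset.sum_mul, ← nsmul_eq_mul]
      refine Finset.sum_le_card_nsmul _ _ _ fun g hg => ?_
      obtain ⟨x, hx, rfl⟩ := Finset.mem_image.1 hg
      refine le_trans (mul_le_mul_of_nonneg_right (Nat.cast_le.2 ?_) hN0.le)
          ((hgood x).1 (hBgood x hx))
      exact Finset.card_le_card (Finset.filter_subset_filter _ (Finset.subset_univ _))
    calc N ^ 2 = N * N := sq N
      _ ≤ (16 * k * B.card) * N := mul_le_mul_of_nonneg_right (by linarith) hN0.le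
      _ = 16 * k * (B.card * N) := by ring
      _ ≤ 16 * k * ((B.image q).card * (8 * k * c)) := by gcongr
      _ = _ := by ring
  · let P : Finset G := E.image fun p => q p.1 * (q p.2)⁻¹
    have hP : (P.card : ℝ) * c ≤ 2 * k * N ^ 2 := by
      have e1 : (P.card : ℝ) * (c / (2 * k)) ≤ ∑ g ∈ P, ((Finset.univ.filter fun p' : ι × ι =>
          q p'.1 * (q p'.2)⁻¹ = g).card : ℝ) := by
        rw [← nsmul_eq_mul]
        refine Finset.card_nsmul_le_sum _ _ _ fun g hg => ?_
        obtain ⟨p, hp, rfl⟩ := Finset.mem_image.1 hg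
        have := (Finset.mem_filter.1 hp).2
        rw [div_le_iff₀ (by positivity)]
        linarith
      have e2 : ∑ g ∈ P, ((Finset.univ.filter fun p' : ι × ι =>
          q p'.1 * (q p'.2)⁻¹ = g).card : ℝ) ≤ N ^ 2 := by
        have := sum_card_fiber_le P (Finset.univ : Finset (ι × ι))
          (fun p' : ι × ι => q p'.1 * (q p'.2)⁻¹)
        rw [Finset.card_univ, Fintype.card_prod] at this
        have := (Nat.cast_le (α := ℝ)).2 this
        rw [Nat.cast_mul, Nat.cast_sum] at this
        rw [sq]
        exact this
      have := e1.trans e2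
      rw [mul_div_assoc', div_le_iff₀ (by positivity)] at this
      linarith
    set H := B.image q * (B.image q)⁻¹ with hH
    let m : (G × G × G × G) → G := fun g => g.1 * g.2.1 * g.2.2.1 * g.2.2.2
    let P4 : Finset (G × G × G × G) := P ×ˢ P ×ˢ P ×ˢ P
    have hrep : ∀ g ∈ H, N ^ 6 ≤ 2 ^ 31 * k ^ 8 * c ^ 3 * (P4.filter fun t => m t = g).card := by
      intro g hg
      obtain ⟨gx, hgx, gy, hgy, rfl⟩ := Finset.mem_mul.1 hg
      obtain ⟨x, hx, rfl⟩ := Finset.mem_image.1 hgx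
      obtain ⟨y, hy, hgy⟩ := Finset.mem_image.1 (Finset.mem_inv'.1 hgy)
      have hgy' : gy = (q y)⁻¹ := by rw [hgy, inv_inv]
      subst hgy'
      have ht0 := hB2 x hx y hy
      set Tr := Finset.univ.filter fun t : ι × ι × ι =>
          r x t.1 ∧ r t.1 t.2.1 ∧ r t.2.1 t.2.2 ∧ r t.2.2 y with hTr
      have ht : N ^ 3 ≤ 2 ^ 12 * (4 * k) ^ 5 * (Tr.card : ℝ) := ht0
      let f : ι × ι × ι → G × G × G × G := fun t => (q x * (q t.1)⁻¹, q t.1 * (q t.2.1)⁻¹,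
        q t.2.1 * (q t.2.2)⁻¹, q t.2.2 * (q y)⁻¹)
      have hfib : (Tr.card : ℝ) * N ^ 3 ≤ (Tr.image f).card * (8 * k * c) ^ 3 := by
        rw [Finset.card_eq_sum_card_image f Tr, Nat.cast_sum, Finset.sum_mul, ← nsmul_eq_mul]
        refine Finset.sum_le_card_nsmul _ _ _ fun u hu => ?_
        obtain ⟨⟨a, z, b⟩, ht, rfl⟩ := Finset.mem_image.1 hu
        have ga := (hgood _).1 ((hrdef _ _).1 (Finset.mem_filter.1 ht).2.1).2.2
        have gz := (hgood _).1 ((hrdef _ _).1 (Finset.mem_filter.1 ht).2.2.1).2.2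
        have gb := (hgood _).1 ((hrdef _ _).1 (Finset.mem_filter.1 ht).2.2.2.1).2.2
        have sub : (Tr.filter fun t => f t = f (a, z, b)) ⊆
            (Finset.univ.filter fun y => q y = q a) ×ˢ (Finset.univ.filter fun y => q y = q z) ×ˢ
              (Finset.univ.filter fun y => q y = q b) := by
          rintro ⟨a', z', b'⟩ hm
          have hm := (Finset.mem_filter.1 hm).2
          simp only [f, Prod.mk.injEq] at hm
          obtain ⟨m1, m2, m3, m4⟩ := hm
          have n1 : q a' = q a := by simpa using m1
          have n4 : q b' = q b := by simpa using m4
          have n2 : q z' = q z := by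
            rw [n1] at m2
            simpa using m2
          exact Finset.mem_product.2 ⟨Finset.mem_filter.2 ⟨Finset.mem_univ _, n1⟩,
            Finset.mem_product.2 ⟨Finset.mem_filter.2 ⟨Finset.mem_univ _, n2⟩,
              Finset.mem_filter.2 ⟨Finset.mem_univ _, n4⟩⟩⟩
        have cs := Finset.card_le_card sub
        rw [Finset.card_product, Finset.card_product] at cs
        have cs' : ((Tr.filter fun t => f t = f (a, z, b)).card : ℝ) ≤ s a * (s z * s b) := by
          have := (Nat.cast_le (α := ℝ)).2 cs
          rw [Nat.cast_mul, Nat.cast_mul] at this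
          exact this
        generalize s a = sa at ga cs'
        generalize s z = sz at gz cs'
        generalize s b = sb at gb cs'
        calc _ ≤ (sa * (sz * sb) : ℝ) * N ^ 3 :=
              mul_le_mul_of_nonneg_right cs' (by positivity)
          _ = (sa * N) * ((sz * N) * (sb * N)) := by ring
          _ ≤ (8 * k * c) * ((8 * k * c) * (8 * k * c)) := by
            gcongr
          _ = _ := by ring
      have him : Tr.image f ⊆ P4.filter fun t => m t = q x * (q y)⁻¹ := by
        intro u hu
        obtain ⟨⟨a, z, b⟩, ht, rfl⟩ := Finset.mem_image.1 hu
        have ht := (Finset.mem_filter.1 ht).2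
        refine Finset.mem_filter.2 ⟨?_, ?_⟩
        · simp only [P4, f, Finset.mem_product]
          exact ⟨Finset.mem_image.2 ⟨_, ((hrdef _ _).1 ht.1).1, rfl⟩,
            Finset.mem_image.2 ⟨_, ((hrdef _ _).1 ht.2.1).1, rfl⟩,
            Finset.mem_image.2 ⟨_, ((hrdef _ _).1 ht.2.2.1).1, rfl⟩,
            Finset.mem_image.2 ⟨_, ((hrdef _ _).1 ht.2.2.2).1, rfl⟩⟩
        · simp only [m, f]
          group
      have him' : ((Tr.image f).card : ℝ) ≤ (P4.filter fun t => m t = q x * (q y)⁻¹).card :=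
        Nat.cast_le.2 (Finset.card_le_card him)
      calc N ^ 6 = N ^ 3 * N ^ 3 := by ring
        _ ≤ (2 ^ 12 * (4 * k) ^ 5 * Tr.card) * N ^ 3 := by gcongr
        _ = 2 ^ 12 * (4 * k) ^ 5 * (Tr.card * N ^ 3) := by ring
        _ ≤ 2 ^ 12 * (4 * k) ^ 5 * ((Tr.image f).card * (8 * k * c) ^ 3) := by gcongr
        _ ≤ 2 ^ 12 * (4 * k) ^ 5 *
            ((P4.filter fun t => m t = q x * (q y)⁻¹).card * (8 * k * c) ^ 3) := by gcongr
        _ = _ := by ring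
    have tot : (H.card : ℝ) * N ^ 6 ≤ 2 ^ 31 * k ^ 8 * c ^ 3 * (P.card : ℝ) ^ 4 := by
      have e1 := Finset.card_nsmul_le_sum H _ _ hrep
      rw [nsmul_eq_mul, ← Finset.mul_sum, ← Nat.cast_sum] at e1
      refine e1.trans (mul_le_mul_of_nonneg_left ?_ (by positivity))
      have e2 := sum_card_fiber_le H P4 m
      have e3 : P4.card = P.card ^ 4 := by
        simp only [P4, Finset.card_product]
        ring
      rw [e3] at e2
      have := (Nat.cast_le (α := ℝ)).2 e2
      rwa [Nat.cast_pow] at this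
    have fin : N ^ 6 * (H.card * c) ≤ N ^ 6 * (2 ^ 35 * k ^ 12 * N ^ 2) := by
      calc N ^ 6 * (H.card * c) = (H.card * N ^ 6) * c := by ring
        _ ≤ (2 ^ 31 * k ^ 8 * c ^ 3 * (P.card : ℝ) ^ 4) * c := by gcongr
        _ = 2 ^ 31 * k ^ 8 * (P.card * c) ^ 4 := by ring
        _ ≤ 2 ^ 31 * k ^ 8 * (2 * k * N ^ 2) ^ 4 := by gcongr
        _ = _ := by ring
    exact le_of_mul_le_mul_left fin (by positivity)

set_option maxHeartbeats 400000 in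
open Classical in
open scoped Pointwise in
theorem exists_symmetric_set_of_collisions {ι G : Type*} [Fintype ι] [Group G] (q : ι → G)
    (hι : 0 < Fintype.card ι) (k : ℝ) (hk : 2 ≤ k)
    (h : (Fintype.card ι : ℝ) ^ 2 * collisions q ≤ k * collisions (pairQuotient q)) :
    ∃ (S : Finset G) (y : G), 1 ∈ S ∧ S⁻¹ = S ∧
      (Fintype.card ι : ℝ) ≤ k ^ 226 * (Finset.univ.filter fun w => y⁻¹ * q w ∈ S).card ∧
      ∀ m : ℕ, ((S ^ m).card : ℝ) * collisions q ≤
        k ^ (226 * (m + 1)) * (Fintype.card ι : ℝ) ^ 2 := by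
  have hk1 : 1 ≤ k := by linarith
  obtain ⟨B, hB1, hB2, hB3⟩ := exists_small_quotients q hι k hk1 h
  set N : ℝ := (Fintype.card ι : ℝ) with hNdef
  have hN0 : 0 < N := Nat.cast_pos.2 hι
  set c : ℝ := (collisions q : ℝ) with hc
  have hBne : B.Nonempty := by
    rw [Finset.nonempty_iff_ne_empty]
    rintro rfl
    rw [Finset.card_empty, Nat.cast_zero, mul_zero] at hB1
    linarith
  set A := B.image q with hA
  have hAne : A.Nonempty := hBne.image q
  have hc0 : 0 < c := by
    have hc0 : 0 ≤ c := Nat.cast_nonneg _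
    rcases hc0.eq_or_lt with h0 | h0
    · rw [← h0] at hB2
      nlinarith
    · exact h0
  set C : ℝ := 2 ^ 42 * k ^ 14 with hC
  have hC1 : 1 ≤ C := by
    have : 1 ≤ k ^ 14 := one_le_pow₀ hk1
    linarith
  have hAA : ((A * A⁻¹).card : ℝ) ≤ C * A.card := by
    refine le_of_mul_le_mul_right (hB3.trans ?_) hc0
    calc 2 ^ 35 * k ^ 12 * N ^ 2 ≤ 2 ^ 35 * k ^ 12 * (2 ^ 7 * k ^ 2 * (A.card * c)) := by gcongr
      _ = _ := by rw [hC]; ring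
  obtain ⟨S₀, hS₀, hS₀A, hS₀T⟩ := exists_popular_quotients A hAne C hC1 hAA
  have hA0 : (0 : ℝ) < A.card := Nat.cast_pos.2 hAne.card_pos
  have hS₀ne : S₀.Nonempty := by
    rw [Finset.nonempty_iff_ne_empty]
    rintro rfl
    rw [Finset.card_empty, Nat.cast_zero, mul_zero] at hS₀A
    linarith
  have hpow : ∀ (j : ℕ) (T : Finset G),
      ((A * S₀ ^ j * T).card : ℝ) ≤ (2 * C ^ 2) ^ j * (A * T).card := by
    intro j
    induction j with
    | zero => intro T; simp
    | succ j ih =>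
      intro T
      have : A * S₀ ^ (j + 1) * T = A * S₀ ^ j * (S₀ * T) := by
        rw [pow_succ, ← mul_assoc, mul_assoc]
      rw [this]
      refine (ih _).trans ?_
      rw [pow_succ (2 * C ^ 2), mul_assoc, ← mul_assoc A]
      exact mul_le_mul_of_nonneg_left (hS₀T T) (by positivity)
  have hpow' : ∀ j : ℕ, ((A * S₀ ^ j).card : ℝ) ≤ (2 * C ^ 2) ^ j * A.card := by
    intro j
    have := hpow j 1
    rwa [mul_one, mul_one] at this
  have hcov : ((A * S₀).card : ℝ) ≤ 4 * C ^ 3 * S₀.card := by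
    have := hpow' 1
    rw [pow_one, pow_one] at this
    calc _ ≤ _ := this
      _ ≤ 2 * C ^ 2 * (2 * C * S₀.card) := by gcongr
      _ = _ := by ring
  obtain ⟨F, hFA, hFC, hAF⟩ := Finset.ruzsa_covering_mul hS₀ne hcov
  have hSS : S₀ / S₀ = S₀ * S₀ := by rw [div_eq_mul_inv, hS₀]
  rw [hSS] at hAF
  set f : G → ℕ := fun y => (Finset.univ.filter fun w => y⁻¹ * q w ∈ S₀ * S₀).card with hf
  have hBle : B.card ≤ ∑ y ∈ F, f y := by
    have : B ⊆ F.biUnion fun y => Finset.univ.filter fun w => y⁻¹ * q w ∈ S₀ * S₀ := by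
      intro w hw
      obtain ⟨y, hy, z, hz, hyz⟩ := Finset.mem_mul.1 (hAF (Finset.mem_image_of_mem q hw))
      refine Finset.mem_biUnion.2 ⟨y, hy, Finset.mem_filter.2 ⟨Finset.mem_univ _, ?_⟩⟩
      rw [← hyz, inv_mul_cancel_left]
      exact hz
    exact (Finset.card_le_card this).trans Finset.card_biUnion_le
  obtain ⟨y, hy, hyB⟩ : ∃ y ∈ F, (B.card : ℝ) ≤ 4 * C ^ 3 * f y := by
    by_contra! hcon
    have hB0 : (0 : ℝ) < B.card := Nat.cast_pos.2 hBne.card_pos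
    have hFne : F.Nonempty := by
      rw [Finset.nonempty_iff_ne_empty]
      rintro rfl
      rw [Finset.sum_empty] at hBle
      have := hBne.card_pos
      omega
    have h1 : (B.card : ℝ) ≤ ∑ y ∈ F, (f y : ℝ) := by
      rw [← Nat.cast_sum]
      exact Nat.cast_le.2 hBle
    have h2 : ∑ y ∈ F, 4 * C ^ 3 * (f y : ℝ) < ∑ y ∈ F, (B.card : ℝ) :=
      Finset.sum_lt_sum_of_nonempty hFne hcon
    rw [← Finset.mul_sum, Finset.sum_const, nsmul_eq_mul] at h2
    have h3 : 4 * C ^ 3 * (B.card : ℝ) ≤ 4 * C ^ 3 * ∑ y ∈ F, (f y : ℝ) := by gcongr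
    have h4 : (F.card : ℝ) * B.card ≤ 4 * C ^ 3 * B.card := by gcongr
    linarith
  refine ⟨S₀ * S₀, y, ?_, ?_, ?_, ?_⟩
  · obtain ⟨g, hg⟩ := hS₀ne
    refine Finset.mem_mul.2 ⟨g, hg, g⁻¹, ?_, mul_inv_cancel g⟩
    rw [← hS₀]
    exact Finset.inv_mem_inv hg
  · rw [mul_inv_rev, hS₀]
  · calc N ≤ 16 * k * B.card := hB1
      _ ≤ 16 * k * (4 * C ^ 3 * f y) := by gcongr
      _ = 2 ^ 132 * k ^ 43 * f y := by rw [hC]; ring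
      _ ≤ k ^ 132 * k ^ 43 * f y := by gcongr
      _ = k ^ 175 * f y := by rw [← pow_add]
      _ ≤ k ^ 226 * f y := by gcongr; norm_num
  · intro m
    have e1 : (((S₀ * S₀) ^ m).card : ℝ) ≤ (2 * C ^ 2) ^ (2 * m) * A.card := by
      refine le_trans (Nat.cast_le.2 ?_) (hpow' (2 * m))
      rw [pow_mul, sq]
      exact Finset.card_le_card_mul_left hAne
    have e2 : (A.card : ℝ) ≤ (A * A⁻¹).card :=
      Nat.cast_le.2 (Finset.card_le_card_mul_right hAne.inv)
    have e3 : 2 * C ^ 2 ≤ k ^ 113 := by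
      calc 2 * C ^ 2 = 2 ^ 85 * k ^ 28 := by rw [hC]; ring
        _ ≤ k ^ 85 * k ^ 28 := by gcongr
        _ = _ := by rw [← pow_add]
    have e4 : (2 : ℝ) ^ 35 * k ^ 12 ≤ k ^ 226 := by
      calc (2 : ℝ) ^ 35 * k ^ 12 ≤ k ^ 35 * k ^ 12 := by gcongr
        _ = k ^ 47 := by rw [← pow_add]
        _ ≤ k ^ 226 := by gcongr; norm_num
    calc (((S₀ * S₀) ^ m).card : ℝ) * c ≤ (2 * C ^ 2) ^ (2 * m) * A.card * c := by gcongr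
      _ ≤ (k ^ 113) ^ (2 * m) * (A * A⁻¹).card * c := by gcongr
      _ = (k ^ 113) ^ (2 * m) * ((A * A⁻¹).card * c) := by ring
      _ ≤ (k ^ 113) ^ (2 * m) * (2 ^ 35 * k ^ 12 * N ^ 2) := by gcongr
      _ ≤ (k ^ 113) ^ (2 * m) * (k ^ 226 * N ^ 2) := by gcongr
      _ = k ^ (226 * (m + 1)) * N ^ 2 := by
        rw [← pow_mul, ← mul_assoc, ← pow_add]
        congr 2
        ring

open Classical in
theorem card_sq_le_card_mul_card_pairs {α β : Type*} (s : Finset α) (t : Finset β) (f : α → β)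
    (hf : ∀ x ∈ s, f x ∈ t) :
    s.card ^ 2 ≤ t.card * ((s ×ˢ s).filter fun p => f p.1 = f p.2).card := by
  have h1 : s.card = ∑ b ∈ t, (s.filter fun x => f x = b).card :=
    Finset.card_eq_sum_card_fiberwise hf
  have h2 : ∑ b ∈ t, (s.filter fun x => f x = b).card ^ 2 ≤
      ((s ×ˢ s).filter fun p => f p.1 = f p.2).card := by
    refine le_trans (Finset.sum_le_sum fun b _ => ?_)
      (sum_card_fiber_le t ((s ×ˢ s).filter fun p => f p.1 = f p.2) (fun p => f p.1))
    rw [sq, ← Finset.card_product]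
    refine Finset.card_le_card ?_
    rintro ⟨x, y⟩ hxy
    simp only [Finset.mem_product, Finset.mem_filter] at hxy ⊢
    exact ⟨⟨⟨hxy.1.1, hxy.2.1⟩, hxy.1.2.trans hxy.2.2.symm⟩, hxy.1.2⟩
  rw [h1]
  exact sq_sum_le_card_mul_sum_sq.trans (Nat.mul_le_mul_left _ h2)

open Classical in
/-- The number of pairs `(w, u)` with `u ∈ U` and `q w • u ∈ U'`. -/
noncomputable def incidences {ι G V : Type*} [Fintype ι] [Group G] [MulAction G V] (q : ι → G)
    (U U' : Finset V) : ℕ :=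
  ((Finset.univ ×ˢ U).filter fun p : ι × V => q p.1 • p.2 ∈ U').card

open Classical in
theorem incidences_sq_le {ι G V : Type*} [Fintype ι] [Group G] [MulAction G V] (q : ι → G)
    (U U' : Finset V) :
    incidences q U U' ^ 2 ≤ U'.card * incidences (pairQuotient q) U U := by
  refine (card_sq_le_card_mul_card_pairs _ U' (fun p : ι × V => q p.1 • p.2)
    fun p hp => (Finset.mem_filter.1 hp).2).trans (Nat.mul_le_mul_left _ ?_)
  refine Finset.card_le_card_of_injOn (fun x => ((x.1.1, x.2.1), x.2.2)) ?_ ?_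
  · rintro ⟨⟨w, u⟩, w', u'⟩ hx
    have hx := Finset.mem_coe.1 hx
    simp only [Finset.mem_filter, Finset.mem_product, Finset.mem_univ, true_and] at hx
    refine Finset.mem_coe.2 (Finset.mem_filter.2 ⟨Finset.mem_product.2
      ⟨Finset.mem_univ _, hx.1.2.1⟩, ?_⟩)
    simp only [pairQuotient, mul_smul]
    rw [← hx.2, inv_smul_smul]
    exact hx.1.1.1
  · rintro ⟨⟨w, u⟩, w', u'⟩ hx ⟨⟨w₁, u₁⟩, w₁', u₁'⟩ hx₁ heq
    have hx := Finset.mem_coe.1 hx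
    have hx₁ := Finset.mem_coe.1 hx₁
    simp only [Finset.mem_filter, Finset.mem_product, Finset.mem_univ, true_and] at hx hx₁
    simp only [Prod.mk.injEq] at heq
    obtain ⟨⟨rfl, rfl⟩, rfl⟩ := heq
    have : u = u₁ := smul_left_cancel (q w) (hx.2.trans hx₁.2.symm)
    rw [this]

open Classical in
theorem incidences_pow_four_le {ι G V : Type*} [Fintype ι] [Group G] [MulAction G V]
    (hG : ∀ (g h : G) (u v : V), u ≠ v → g • u = h • u → g • v = h • v → g = h)
    (q : ι → G) (U U' : Finset V) (hI : 2 * Fintype.card ι ≤ incidences q U U') :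
    incidences q U U' ^ 4 ≤
      4 * Fintype.card ι ^ 2 * (U.card ^ 4 * U'.card ^ 2 * collisions q) := by
  set I := incidences q U U' with hIdef
  set T : Finset (ι × V × V) := (Finset.univ ×ˢ U ×ˢ U).filter fun p =>
    p.2.1 ≠ p.2.2 ∧ q p.1 • p.2.1 ∈ U' ∧ q p.1 • p.2.2 ∈ U' with hT
  have h1 : I ^ 2 ≤ Fintype.card ι * (T.card + I) := by
    have := card_sq_le_card_mul_card_pairs
      ((Finset.univ ×ˢ U).filter fun p : ι × V => q p.1 • p.2 ∈ U') Finset.univ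
      (fun p : ι × V => p.1) fun p _ => Finset.mem_univ _
    refine this.trans (Nat.mul_le_mul_left _ ?_)
    rw [hIdef, incidences, ← Finset.card_disjSum]
    refine Finset.card_le_card_of_injOn (fun x => if x.1.2 = x.2.2 then Sum.inr x.1 else
      Sum.inl (x.1.1, x.1.2, x.2.2)) ?_ ?_
    · rintro ⟨⟨w, u⟩, w', u'⟩ hx
      have hx := Finset.mem_coe.1 hx
      simp only [Finset.mem_filter, Finset.mem_product, Finset.mem_univ, true_and] at hx
      obtain ⟨⟨⟨h1, h2⟩, h3, h4⟩, rfl⟩ := hx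
      refine Finset.mem_coe.2 ?_
      dsimp only
      split_ifs with h
      · simp [h1, h2]
      · simp [hT, h1, h2, h3, h4, h]
    · rintro ⟨⟨w, u⟩, w', u'⟩ hx ⟨⟨w₁, u₁⟩, w₁', u₁'⟩ hx₁ heq
      have hx := (Finset.mem_filter.1 (Finset.mem_coe.1 hx)).2
      have hx₁ := (Finset.mem_filter.1 (Finset.mem_coe.1 hx₁)).2
      dsimp only at hx hx₁ heq
      split_ifs at heq with h h'
      all_goals simp_all
  have h2 : T.card ^ 2 ≤ U.card ^ 4 * U'.card ^ 2 * collisions q := by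
    have := card_sq_le_card_mul_card_pairs T ((U ×ˢ U) ×ˢ (U' ×ˢ U'))
      (fun p => ((p.2.1, p.2.2), (q p.1 • p.2.1, q p.1 • p.2.2))) (by
        rintro ⟨w, u, v⟩ hx
        simp only [hT, Finset.mem_filter, Finset.mem_product, Finset.mem_univ, true_and] at hx ⊢
        exact ⟨hx.1, hx.2.2⟩)
    refine this.trans ?_
    have h3 : ((T ×ˢ T).filter fun p : (ι × V × V) × (ι × V × V) =>
        (((p.1.2.1, p.1.2.2), (q p.1.1 • p.1.2.1, q p.1.1 • p.1.2.2)) : (V × V) × (V × V)) =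
        ((p.2.2.1, p.2.2.2), (q p.2.1 • p.2.2.1, q p.2.1 • p.2.2.2))).card ≤
        (U.card * U.card) * collisions q := by
      rw [collisions, ← Finset.card_product, ← Finset.card_product]
      refine Finset.card_le_card_of_injOn (fun x => ((x.1.2.1, x.1.2.2), (x.1.1, x.2.1))) ?_ ?_
      · rintro ⟨⟨w, u, v⟩, w', u', v'⟩ hx
        have hx := Finset.mem_coe.1 hx
        simp only [hT, Finset.mem_filter, Finset.mem_product, Finset.mem_univ, true_and,
          Prod.mk.injEq] at hx
        obtain ⟨⟨⟨h1, h2, h3⟩, -⟩, ⟨rfl, rfl⟩, h4, h5⟩ := hx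
        refine Finset.mem_coe.2 (Finset.mem_product.2 ⟨Finset.mem_product.2 h1,
          Finset.mem_filter.2 ⟨Finset.mem_univ _, ?_⟩⟩)
        exact hG _ _ u v h2 h4 h5
      · rintro ⟨⟨w, u, v⟩, w', u', v'⟩ hx ⟨⟨w₁, u₁, v₁⟩, w₁', u₁', v₁'⟩ hx₁ heq
        have hx := (Finset.mem_filter.1 (Finset.mem_coe.1 hx)).2
        have hx₁ := (Finset.mem_filter.1 (Finset.mem_coe.1 hx₁)).2
        simp only [Prod.mk.injEq] at hx hx₁ heq ⊢
        obtain ⟨⟨rfl, rfl⟩, rfl, rfl⟩ := heq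
        exact ⟨⟨rfl, rfl, rfl⟩, rfl, hx.1.1.symm.trans hx₁.1.1, hx.1.2.symm.trans hx₁.1.2⟩
    refine (Nat.mul_le_mul le_rfl (?_ : _ ≤ (U.card * U.card) * collisions q)).trans (le_of_eq ?_)
    · convert h3
    simp only [Finset.card_product]
    ring
  have h4 : I ^ 2 ≤ 2 * Fintype.card ι * T.card := by nlinarith
  calc I ^ 4 = (I ^ 2) ^ 2 := by ring
    _ ≤ (2 * Fintype.card ι * T.card) ^ 2 := Nat.pow_le_pow_left h4 2
    _ = 4 * Fintype.card ι ^ 2 * T.card ^ 2 := by ring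
    _ ≤ _ := Nat.mul_le_mul_left _ h2

/-- `Word α j` is the type of `2 ^ j`-tuples of elements of `α`, arranged in a binary tree. -/
def Word (α : Type*) : ℕ → Type _
  | 0 => α
  | j + 1 => Word α j × Word α j

noncomputable instance Word.instFintype {α : Type*} [Fintype α] : (j : ℕ) → Fintype (Word α j)
  | 0 => inferInstanceAs (Fintype α)
  | j + 1 =>
    haveI := Word.instFintype (α := α) j
    inferInstanceAs (Fintype (Word α j × Word α j))

/-- Iterated quotients of a map `g` into a group, indexed by binary trees. -/
def evalWord {α G : Type*} [Group G] (g : α → G) : (j : ℕ) → Word α j → G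
  | 0 => g
  | j + 1 => pairQuotient (evalWord g j)

theorem card_word_succ (α : Type*) [Fintype α] (j : ℕ) :
    Fintype.card (Word α (j + 1)) = Fintype.card (Word α j) ^ 2 := by
  rw [sq]
  exact Fintype.card_prod (Word α j) (Word α j)

theorem card_word_pos (α : Type*) [Fintype α] (h : 0 < Fintype.card α) (j : ℕ) :
    0 < Fintype.card (Word α j) := by
  induction j with
  | zero => exact h
  | succ j ih =>
    rw [card_word_succ]
    exact pow_pos ih 2

open Classical in
theorem exists_card_le_of_word {α G : Type*} [Fintype α] [Group G] (g : α → G) (S : Finset G)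
    (c : ℝ) (h : 0 < Fintype.card α) (j : ℕ) (y : G)
    (hy : (Fintype.card (Word α j) : ℝ) ≤
      c * (Finset.univ.filter fun w => y⁻¹ * evalWord g j w ∈ S).card) :
    ∃ z, (Fintype.card α : ℝ) ≤ c * (Finset.univ.filter fun x => z⁻¹ * g x ∈ S).card := by
  induction j generalizing y with
  | zero => exact ⟨y, hy⟩
  | succ j ih =>
    have hsum : (Finset.univ.filter fun w => y⁻¹ * evalWord g (j + 1) w ∈ S).card =
        ∑ w : Word α j,
          (Finset.univ.filter fun w' => (evalWord g j w * y)⁻¹ * evalWord g j w' ∈ S).card := by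
      have : (Finset.univ.filter fun p : Word α j × Word α j =>
          y⁻¹ * pairQuotient (evalWord g j) p ∈ S).card = ∑ w : Word α j,
          (Finset.univ.filter fun w' => (evalWord g j w * y)⁻¹ * evalWord g j w' ∈ S).card := by
        rw [Finset.card_filter, ← Finset.univ_product_univ, Finset.sum_product]
        refine Finset.sum_congr rfl fun w _ => ?_
        rw [Finset.card_filter]
        simp only [pairQuotient, mul_inv_rev, mul_assoc]
        refine Finset.sum_congr rfl fun _ _ => ?_
        congr
      exact this
    by_contra! hcon
    have hW := card_word_pos α h j
    have hlt : ∑ w : Word α j, c * ((Finset.univ.filter fun w' =>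
          (evalWord g j w * y)⁻¹ * evalWord g j w' ∈ S).card : ℝ) <
        ∑ _w : Word α j, (Fintype.card (Word α j) : ℝ) := by
      refine Finset.sum_lt_sum_of_nonempty
        (Finset.univ_nonempty_iff.2 (Fintype.card_pos_iff.1 hW)) fun w _ => ?_
      by_contra! hle
      obtain ⟨z, hz⟩ := ih _ hle
      exact (hcon z).not_ge hz
    rw [← Finset.mul_sum, ← Nat.cast_sum, ← hsum, Finset.sum_const, nsmul_eq_mul,
      Finset.card_univ] at hlt
    rw [card_word_succ, Nat.cast_pow, sq] at hy
    exact hlt.not_ge hy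

set_option maxHeartbeats 400000 in
open Classical in
open scoped Pointwise in
theorem exists_symmetric_set_of_incidences {α G V : Type*} [Fintype α] [Group G] [MulAction G V]
    (hG : ∀ (g h : G) (u v : V), u ≠ v → g • u = h • u → g • v = h • v → g = h)
    (g : α → G) (U U' : Finset V) (n : ℝ) (hn : (Fintype.card α : ℝ) = n)
    (hU : (U.card : ℝ) ≤ n) (hU' : (U'.card : ℝ) ≤ n) (J : ℕ) (k L : ℝ) (hk : 2 ≤ k)
    (hkJ : n ^ 5 ≤ k ^ J) (hL : 1 ≤ L) (hI : n ^ 2 ≤ L * incidences g U U')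
    (hL1 : 2 * L ^ 2 ^ J ≤ n) (hL2 : 8 * (L ^ 2 ^ J) ^ 4 ≤ n ^ 3) :
    ∃ (S : Finset G) (y : G), 1 ∈ S ∧ S⁻¹ = S ∧
      n ≤ k ^ 226 * (Finset.univ.filter fun x => y⁻¹ * g x ∈ S).card ∧
      ∀ m : ℕ, ((S ^ m).card : ℝ) ≤ k ^ (226 * (m + 1)) * n ^ 5 := by
  have hM1 : 1 ≤ L ^ 2 ^ J := one_le_pow₀ hL
  have hn0 : 0 < n := by linarith
  have hα : 0 < Fintype.card α := by
    rw [← hn] at hn0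
    exact Nat.cast_pos.1 hn0
  set W : ℕ → ℝ := fun j => (Fintype.card (Word α j) : ℝ) with hW
  have hW0 : ∀ j, 0 < W j := fun j => Nat.cast_pos.2 (card_word_pos α hα j)
  have hWs : ∀ j, W (j + 1) = W j ^ 2 := fun j => by
    simp only [hW, card_word_succ, Nat.cast_pow]
  set c : ℕ → ℝ := fun j => (collisions (evalWord g j) : ℝ) with hc
  have hinc : ∀ j, ∃ U'' : Finset V, (U''.card : ℝ) ≤ n ∧
      W j * n ≤ L ^ 2 ^ j * incidences (evalWord g j) U U'' := by
    intro j
    induction j with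
    | zero =>
      refine ⟨U', hU', ?_⟩
      have : W 0 = n := hn
      rw [this, pow_zero, pow_one, ← sq]
      exact hI
    | succ j ih =>
      obtain ⟨U'', h1, h2⟩ := ih
      refine ⟨U, hU, ?_⟩
      have h3 := (Nat.cast_le (α := ℝ)).2 (incidences_sq_le (evalWord g j) U U'')
      rw [Nat.cast_pow, Nat.cast_mul] at h3
      have h4 : (incidences (pairQuotient (evalWord g j)) U U : ℝ) =
        incidences (evalWord g (j + 1)) U U := rfl
      rw [h4] at h3
      have h5 : n * (W (j + 1) * n) ≤
          n * (L ^ 2 ^ (j + 1) * incidences (evalWord g (j + 1)) U U) := by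
        calc n * (W (j + 1) * n) = (W j * n) ^ 2 := by rw [hWs]; ring
          _ ≤ (L ^ 2 ^ j * incidences (evalWord g j) U U'') ^ 2 := by
            have := (hW0 j).le
            gcongr
          _ = L ^ 2 ^ (j + 1) * (incidences (evalWord g j) U U'' : ℝ) ^ 2 := by
            rw [mul_pow, ← pow_mul, pow_succ 2 j]
          _ ≤ L ^ 2 ^ (j + 1) * (U''.card * incidences (evalWord g (j + 1)) U U) := by gcongr
          _ ≤ L ^ 2 ^ (j + 1) * (n * incidences (evalWord g (j + 1)) U U) := by gcongr
          _ = _ := by ring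
      exact le_of_mul_le_mul_left h5 hn0
  have hcol : ∀ j ≤ J, 2 * W j ^ 2 ≤ n ^ 5 * c j := by
    intro j hj
    obtain ⟨U'', h1, h2⟩ := hinc j
    set I : ℝ := (incidences (evalWord g j) U U'' : ℝ) with hIdef
    have hI0 : 0 ≤ I := Nat.cast_nonneg _
    have hLj : L ^ 2 ^ j ≤ L ^ 2 ^ J :=
      pow_le_pow_right₀ hL (Nat.pow_le_pow_right (by norm_num) hj)
    have h3 : W j * n ≤ L ^ 2 ^ J * I := h2.trans (by gcongr)
    have h4 : 2 * W j ≤ I := by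
      have : L ^ 2 ^ J * (2 * W j) ≤ L ^ 2 ^ J * I := by
        refine le_trans ?_ h3
        have := mul_le_mul_of_nonneg_right hL1 (hW0 j).le
        linarith
      exact le_of_mul_le_mul_left this (by linarith)
    have h5 : 2 * Fintype.card (Word α j) ≤ incidences (evalWord g j) U U'' := by
      have : ((2 * Fintype.card (Word α j) : ℕ) : ℝ) ≤ incidences (evalWord g j) U U'' := by
        rw [Nat.cast_mul, Nat.cast_ofNat]
        exact h4
      exact Nat.cast_le.1 this
    have h6 := (Nat.cast_le (α := ℝ)).2 (incidences_pow_four_le hG _ _ _ h5)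
    simp only [Nat.cast_mul, Nat.cast_pow, Nat.cast_ofNat] at h6
    have h7 : I ^ 4 ≤ 4 * W j ^ 2 * (n ^ 4 * n ^ 2 * c j) := by
      refine h6.trans ?_
      have : 0 ≤ c j := Nat.cast_nonneg _
      gcongr
    have h8 : (4 * W j ^ 2 * n ^ 4) * (2 * W j ^ 2) ≤ (4 * W j ^ 2 * n ^ 4) * (n ^ 5 * c j) := by
      calc (4 * W j ^ 2 * n ^ 4) * (2 * W j ^ 2) = 8 * (W j * n) ^ 4 := by ring
        _ ≤ 8 * (L ^ 2 ^ J * I) ^ 4 := by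
          have := (hW0 j).le
          gcongr
        _ = 8 * (L ^ 2 ^ J) ^ 4 * I ^ 4 := by ring
        _ ≤ n ^ 3 * (4 * W j ^ 2 * (n ^ 4 * n ^ 2 * c j)) := by gcongr
        _ = _ := by ring
    have := hW0 j
    exact le_of_mul_le_mul_left h8 (by positivity)
  obtain ⟨j, hj, hjk⟩ : ∃ j < J, W j ^ 2 * c j ≤ k * c (j + 1) := by
    by_contra! hcon
    have hdown : ∀ j ≤ J, k ^ j * c j ≤ W j ^ 2 := by
      intro j hj
      induction j with
      | zero =>
        rw [pow_zero, one_mul]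
        have : collisions (evalWord g 0) ≤ Fintype.card (Word α 0) ^ 2 := by
          rw [collisions, sq, ← Fintype.card_prod, ← Finset.card_univ]
          exact Finset.card_le_card (Finset.filter_subset _ _)
        have := (Nat.cast_le (α := ℝ)).2 this
        rwa [Nat.cast_pow] at this
      | succ j ih =>
        have h1 := ih (by omega)
        have h2 := hcon j (by omega)
        calc k ^ (j + 1) * c (j + 1) = k ^ j * (k * c (j + 1)) := by ring
          _ ≤ k ^ j * (W j ^ 2 * c j) := by gcongr
          _ = W j ^ 2 * (k ^ j * c j) := by ring
          _ ≤ W j ^ 2 * W j ^ 2 := by gcongr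
          _ = _ := by rw [hWs]; ring
    have h1 := hdown J le_rfl
    have h2 := hcol J le_rfl
    have h3 : n ^ 5 * c J ≤ k ^ J * c J :=
      mul_le_mul_of_nonneg_right hkJ (Nat.cast_nonneg _)
    have := pow_pos (hW0 J) 2
    linarith
  obtain ⟨S, y, hS1, hSi, hSy, hSm⟩ :=
    exists_symmetric_set_of_collisions (evalWord g j) (card_word_pos α hα j) k hk hjk
  obtain ⟨z, hz⟩ := exists_card_le_of_word g S _ hα j y hSy
  refine ⟨S, z, hS1, hSi, hn ▸ hz, fun m => ?_⟩
  have h1 := hcol j hj.le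
  have hW2 := pow_pos (hW0 j) 2
  have hcj : 0 < c j := by
    have : 0 ≤ c j := Nat.cast_nonneg _
    rcases this.eq_or_lt with h0 | h0
    · rw [← h0, mul_zero] at h1
      linarith
    · exact h0
  refine le_of_mul_le_mul_right ((hSm m).trans ?_) hcj
  rw [mul_assoc]
  have : (Fintype.card (Word α j) : ℝ) ^ 2 ≤ n ^ 5 * c j := by
    have : W j ^ 2 ≤ n ^ 5 * c j := by linarith
    exact this
  gcongr

theorem exists_injOn_combination {K : Type*} [Field K] (S : Finset K) (hS : 2 ≤ S.card)
    (hchar : ∀ j : ℕ, 0 < j → j ≤ S.card ^ 4 → (j : K) ≠ 0) :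
    ∃ a ∈ S, ∃ b ∈ S, ∃ c ∈ S, ∃ d ∈ S, ∀ s ∈ S, ∀ s' ∈ S, ∀ t ∈ S, ∀ t' ∈ S,
      (c - d) * s + (a - b + c - d) * s' = (c - d) * t + (a - b + c - d) * t' →
        s = t ∧ s' = t' := by
  classical
  set Q : Finset (K × K × K × K) := (S ×ˢ S ×ˢ S ×ˢ S).filter fun p => p.2.2.1 ≠ p.2.2.2 with hQ
  set R : Finset K := Q.image fun p => (p.1 - p.2.1) / (p.2.2.1 - p.2.2.2) with hR
  have hRcard : R.card ≤ S.card ^ 4 := by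
    refine Finset.card_image_le.trans ((Finset.card_filter_le _ _).trans (le_of_eq ?_))
    simp only [Finset.card_product]
    ring
  have hmem : ∀ a ∈ S, ∀ b ∈ S, ∀ c ∈ S, ∀ d ∈ S, c ≠ d → (a - b) / (c - d) ∈ R := by
    intro a ha b hb c hc d hd hcd
    refine Finset.mem_image.2 ⟨(a, b, c, d), Finset.mem_filter.2 ⟨?_, hcd⟩, rfl⟩
    simp only [Finset.mem_product]
    exact ⟨ha, hb, hc, hd⟩
  obtain ⟨r, hr, hr1⟩ : ∃ r ∈ R, r + 1 ∉ R := by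
    by_contra! hcon
    have hnat : ∀ j : ℕ, (j : K) ∈ R := by
      intro j
      induction j with
      | zero =>
        obtain ⟨c, hc, d, hd, hcd⟩ := Finset.one_lt_card.1 hS
        have := hmem c hc c hc c hc d hd hcd
        rwa [sub_self, zero_div, ← Nat.cast_zero] at this
      | succ j ih =>
        rw [Nat.cast_succ]
        exact hcon _ ih
    have hinj : Set.InjOn (fun j : ℕ => (j : K)) (Finset.range (S.card ^ 4 + 1) : Finset ℕ) := by
      have key : ∀ i j : ℕ, j ≤ S.card ^ 4 → i < j → (i : K) ≠ j := by
        intro i j hj hij h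
        refine hchar (j - i) (by omega) (by omega) ?_
        rw [Nat.cast_sub hij.le, h, sub_self]
      intro i hi j hj hij
      have hi := Finset.mem_range.1 (Finset.mem_coe.1 hi)
      have hj := Finset.mem_range.1 (Finset.mem_coe.1 hj)
      rcases lt_trichotomy i j with h | h | h
      · exact absurd hij (key i j (by omega) h)
      · exact h
      · exact absurd hij.symm (key j i (by omega) h)
    have h1 := Finset.card_le_card_of_injOn (t := R) _ (fun j _ => hnat j) hinj
    rw [Finset.card_range] at h1
    omega
  obtain ⟨⟨a, b, c, d⟩, hp, rfl⟩ := Finset.mem_image.1 hr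
  obtain ⟨hp, hcd⟩ := Finset.mem_filter.1 hp
  simp only [Finset.mem_product] at hp
  obtain ⟨ha, hb, hc, hd⟩ := hp
  have hcd0 : c - d ≠ 0 := sub_ne_zero.2 hcd
  refine ⟨a, ha, b, hb, c, hc, d, hd, fun s hs s' hs' t ht t' ht' h => ?_⟩
  have hs't' : s' = t' := by
    by_contra hne
    refine hr1 ?_
    have h0 : t' - s' ≠ 0 := sub_ne_zero.2 (Ne.symm hne)
    have : (a - b) / (c - d) + 1 = (s - t) / (t' - s') := by
      rw [div_add_one hcd0, div_eq_div_iff hcd0 h0]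
      linear_combination -h
    dsimp only
    rw [this]
    exact hmem s hs t ht t' ht' s' hs' (Ne.symm hne)
  subst hs't'
  exact ⟨mul_left_cancel₀ hcd0 (add_right_cancel h), rfl⟩

/-- The sequence defined by `c`, `6 c²`, `6 (6 c²)²`, … -/
def growthIndex (c : ℕ) : ℕ → ℕ
  | 0 => c
  | t + 1 => 6 * growthIndex c t ^ 2

theorem exists_finset_card_pow {K : Type*} [Field K] (E : ℕ → Set K)
    (hadd : ∀ c c' x y, x ∈ E c → y ∈ E c' → x + y ∈ E (c + c'))
    (hneg : ∀ c x, x ∈ E c → -x ∈ E c)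
    (hmul : ∀ c c' x y, x ∈ E c → y ∈ E c' → x * y ∈ E (c * c'))
    (Λ : Finset K) (hΛ : 2 ≤ Λ.card) (c : ℕ) (hc : (Λ : Set K) ⊆ E c) (t : ℕ)
    (hchar : ∀ j : ℕ, 0 < j → j ≤ Λ.card ^ (4 * 2 ^ t) → (j : K) ≠ 0) :
    ∃ S : Finset K, S.card = Λ.card ^ 2 ^ t ∧ (S : Set K) ⊆ E (growthIndex c t) := by
  classical
  induction t with
  | zero => exact ⟨Λ, by simp, hc⟩
  | succ t ih =>
    obtain ⟨S, hS, hSE⟩ := ih fun j hj hj' =>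
      hchar j hj (hj'.trans (Nat.pow_le_pow_right (by omega) (by rw [pow_succ]; omega)))
    have hS2 : 2 ≤ S.card := by
      rw [hS]
      exact hΛ.trans (Nat.le_self_pow (by positivity) _)
    obtain ⟨a, ha, b, hb, d, hd, e, he, hinj⟩ := exists_injOn_combination S hS2 fun j hj hj' =>
      hchar j hj (hj'.trans (by
        rw [hS, ← pow_mul]
        exact Nat.pow_le_pow_right (by omega) (by rw [pow_succ]; omega)))
    refine ⟨(S ×ˢ S).image fun p => (d - e) * p.1 + (a - b + d - e) * p.2, ?_, ?_⟩
    · rw [Finset.card_image_of_injOn, Finset.card_product, hS, pow_succ, pow_mul, sq]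
      rintro ⟨s, s'⟩ hs ⟨r, r'⟩ hr h
      have hs := Finset.mem_product.1 (Finset.mem_coe.1 hs)
      have hr := Finset.mem_product.1 (Finset.mem_coe.1 hr)
      obtain ⟨h1, h2⟩ := hinj s hs.1 s' hs.2 r hr.1 r' hr.2 h
      exact Prod.ext h1 h2
    · intro z hz
      obtain ⟨⟨s, s'⟩, hs, rfl⟩ := Finset.mem_image.1 (Finset.mem_coe.1 hz)
      have hs := Finset.mem_product.1 hs
      have h1 : d - e ∈ E (growthIndex c t + growthIndex c t) := by
        rw [sub_eq_add_neg]
        exact hadd _ _ _ _ (hSE hd) (hneg _ _ (hSE he))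
      have h2 : a - b + d - e ∈
          E (growthIndex c t + growthIndex c t + (growthIndex c t + growthIndex c t)) := by
        rw [add_sub_assoc, sub_eq_add_neg a]
        exact hadd _ _ _ _ (hadd _ _ _ _ (hSE ha) (hneg _ _ (hSE hb))) h1
      have h3 := hadd _ _ _ _ (hmul _ _ _ _ h1 (hSE hs.1)) (hmul _ _ _ _ h2 (hSE hs.2))
      have h4 : (growthIndex c t + growthIndex c t) * growthIndex c t +
          (growthIndex c t + growthIndex c t + (growthIndex c t + growthIndex c t)) *
            growthIndex c t = growthIndex c (t + 1) := by
        rw [growthIndex]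
        ring
      rwa [h4] at h3

/-- The affine map `u ↦ scale • u + shift` with invertible scale. -/
@[ext] structure ScaleShift (K V : Type*) [Field K] [AddCommGroup V] [Module K V] where
  scale : Kˣ
  shift : V

namespace ScaleShift

variable {K V : Type*} [Field K] [AddCommGroup V] [Module K V]

instance : Mul (ScaleShift K V) := ⟨fun g h => ⟨g.scale * h.scale, g.scale • h.shift + g.shift⟩⟩

instance : One (ScaleShift K V) := ⟨⟨1, 0⟩⟩

instance : Inv (ScaleShift K V) := ⟨fun g => ⟨g.scale⁻¹, -(g.scale⁻¹ • g.shift)⟩⟩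

@[simp] theorem scale_mul (g h : ScaleShift K V) : (g * h).scale = g.scale * h.scale := rfl

@[simp] theorem shift_mul (g h : ScaleShift K V) :
    (g * h).shift = g.scale • h.shift + g.shift := rfl

@[simp] theorem scale_one : (1 : ScaleShift K V).scale = 1 := rfl

@[simp] theorem shift_one : (1 : ScaleShift K V).shift = 0 := rfl

@[simp] theorem scale_inv (g : ScaleShift K V) : g⁻¹.scale = g.scale⁻¹ := rfl

@[simp] theorem shift_inv (g : ScaleShift K V) : g⁻¹.shift = -(g.scale⁻¹ • g.shift) := rfl

instance : Group (ScaleShift K V) :=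
  Group.ofLeftAxioms
    (fun g h k => by ext1 <;> simp [mul_assoc, mul_smul, smul_add, add_assoc])
    (fun g => by ext1 <;> simp)
    (fun g => by ext1 <;> simp)

instance : MulAction (ScaleShift K V) V where
  smul g u := g.scale • u + g.shift
  one_smul u := by
    change (1 : Kˣ) • u + (0 : V) = u
    simp
  mul_smul g h u := by
    change (g.scale * h.scale) • u + (g.scale • h.shift + g.shift) =
      g.scale • (h.scale • u + h.shift) + g.shift
    rw [mul_smul, smul_add, add_assoc]

theorem smul_def (g : ScaleShift K V) (u : V) : g • u = g.scale • u + g.shift := rfl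

theorem eq_of_smul_eq_smul (g h : ScaleShift K V) (u v : V) (huv : u ≠ v) (hu : g • u = h • u)
    (hv : g • v = h • v) : g = h := by
  rw [smul_def, smul_def, Units.smul_def, Units.smul_def] at hu hv
  have h1 : ((g.scale : K) - h.scale) • (u - v) = 0 := by
    linear_combination (norm := module) hu - hv
  have h2 : (g.scale : K) = h.scale := by
    rcases smul_eq_zero.1 h1 with h | h
    · exact sub_eq_zero.1 h
    · exact absurd (sub_eq_zero.1 h) huv
  rw [h2] at hu
  exact ScaleShift.ext (Units.ext h2) (add_left_cancel hu)

theorem eq_of_smul_eq_self (g : ScaleShift K V) (u v : V) (hg : g.scale ≠ 1) (hu : g • u = u)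
    (hv : g • v = v) : u = v := by
  by_contra huv
  have : g = 1 := eq_of_smul_eq_smul g 1 u v huv (by rw [hu, one_smul]) (by rw [hv, one_smul])
  rw [this] at hg
  exact hg rfl

theorem exists_smul_eq_self (g : ScaleShift K V) (hg : g.scale ≠ 1) : ∃ u : V, g • u = u := by
  have h0 : (1 : K) - g.scale ≠ 0 := by
    rw [sub_ne_zero]
    exact fun h => hg (Units.ext h.symm)
  refine ⟨((1 : K) - g.scale)⁻¹ • g.shift, ?_⟩
  rw [smul_def, Units.smul_def]
  have h1 : ((1 : K) - g.scale) • ((1 : K) - g.scale)⁻¹ • g.shift = g.shift := by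
    rw [smul_smul, mul_inv_cancel₀ h0, one_smul]
  nth_rewrite 2 [← h1]
  rw [sub_smul, one_smul]
  abel

end ScaleShift

open scoped commutatorElement in
open Classical in
open scoped Pointwise in
theorem exists_translation_mem_pow {K V : Type*} [Field K] [AddCommGroup V] [Module K V]
    {α : Type*} (a : α → Kˣ) (c : α → V) (X : Finset α) (S : Finset (ScaleShift K V))
    (hS : S⁻¹ = S) (x₀ : α)
    (hX : ∀ x ∈ X, (⟨-a x₀, c x₀⟩ : ScaleShift K V)⁻¹ * ⟨-a x, c x⟩ ∈ S ^ 2)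
    (hscale : ∃ x ∈ X, a x ≠ a x₀) (hline : ∀ u v : V, ∃ x ∈ X, c x ≠ v + (a x : K) • u) :
    ∃ τ : V, τ ≠ 0 ∧ (⟨1, τ⟩ : ScaleShift K V) ∈ S ^ 8 := by
  set g : α → ScaleShift K V := fun x => ⟨-a x, c x⟩ with hg
  have hinv : ∀ h : ScaleShift K V, h ∈ S ^ 2 → h⁻¹ ∈ S ^ 2 := by
    intro h hh
    have := Finset.inv_mem_inv hh
    rwa [← inv_pow, hS] at this
  obtain ⟨x₁, hx₁, ha₁⟩ := hscale
  set h₁ := (g x₀)⁻¹ * g x₁ with hh₁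
  have hs₁ : h₁.scale ≠ 1 := by
    intro h
    have h' : (-a x₀)⁻¹ * (-a x₁) = 1 := h
    rw [inv_mul_eq_one, neg_inj] at h'
    exact ha₁ h'.symm
  obtain ⟨u, hu⟩ := ScaleShift.exists_smul_eq_self h₁ hs₁
  obtain ⟨x₂, hx₂, hne⟩ : ∃ x ∈ X, ⁅h₁, (g x₀)⁻¹ * g x⁆ ≠ 1 := by
    by_contra! hcon
    obtain ⟨x, hx, hxl⟩ := hline u (g x₀ • u)
    apply hxl
    have hcomm := commutatorElement_eq_one_iff_mul_comm.1 (hcon x hx)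
    have h1 : h₁ • ((g x₀)⁻¹ * g x) • u = ((g x₀)⁻¹ * g x) • u := by
      rw [← mul_smul, hcomm, mul_smul, hu]
    have h2 := ScaleShift.eq_of_smul_eq_self h₁ _ _ hs₁ h1 hu
    rw [mul_smul, inv_smul_eq_iff] at h2
    rw [← h2, ScaleShift.smul_def, Units.smul_def]
    simp [hg]
  have hmem : ⁅h₁, (g x₀)⁻¹ * g x₂⁆ ∈ S ^ 8 := by
    have : S ^ 8 = S ^ 2 * S ^ 2 * S ^ 2 * S ^ 2 := by simp only [← pow_add]
    rw [this, commutatorElement_def]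
    exact Finset.mul_mem_mul (Finset.mul_mem_mul (Finset.mul_mem_mul (hX _ hx₁) (hX _ hx₂))
      (hinv _ (hX _ hx₁))) (hinv _ (hX _ hx₂))
  have hsc : ⁅h₁, (g x₀)⁻¹ * g x₂⁆.scale = 1 := by
    rw [commutatorElement_def]
    simp only [ScaleShift.scale_mul, ScaleShift.scale_inv]
    rw [mul_right_comm, mul_inv_cancel_right]
    exact mul_inv_cancel _
  refine ⟨⁅h₁, (g x₀)⁻¹ * g x₂⁆.shift, ?_, ?_⟩
  · intro h0
    exact hne (ScaleShift.ext hsc h0)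
  · rw [← hsc]
    exact hmem

open Classical in
open scoped Pointwise in
theorem card_pow_le_card_pow_mul {K V : Type*} [Field K] [AddCommGroup V] [Module K V]
    {α : Type*} (a : α → Kˣ) (c : α → V) (X : Finset α) (S : Finset (ScaleShift K V))
    (hS1 : 1 ∈ S) (hS : S⁻¹ = S)
    (hX : ∀ x ∈ X, ∀ x' ∈ X, (⟨-a x, c x⟩ : ScaleShift K V)⁻¹ * ⟨-a x', c x'⟩ ∈ S ^ 2)
    (ℓ : ℝ) (hℓ : ℓ < X.card) (hℓ0 : 0 ≤ ℓ)
    (hscale : ∀ b : Kˣ, ((X.filter fun x => a x = b).card : ℝ) ≤ ℓ)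
    (hline : ∀ u v : V, ((X.filter fun x => c x = v + (a x : K) • u).card : ℝ) ≤ ℓ) (t : ℕ)
    (hchar : ∀ j : ℕ, 0 < j → j ≤ X.card ^ (4 * 2 ^ t) → (j : K) ≠ 0) :
    (X.card : ℝ) ^ 2 ^ t ≤ ℓ ^ 2 ^ t * (S ^ (growthIndex 5 t * 8)).card := by
  have hXne : X.Nonempty := by
    rw [← Finset.card_pos]
    exact Nat.cast_pos.1 (hℓ0.trans_lt hℓ)
  obtain ⟨x₀, hx₀⟩ := hXne
  obtain ⟨τ, hτ0, hτ⟩ := exists_translation_mem_pow a c X S hS x₀ (hX x₀ hx₀) (by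
      by_contra! hcon
      have := hscale (a x₀)
      rw [Finset.filter_true_of_mem hcon] at this
      exact this.not_gt hℓ) (by
      intro u v
      by_contra! hcon
      have := hline u v
      rw [Finset.filter_true_of_mem hcon] at this
      exact this.not_gt hℓ)
  have hinv : ∀ m, (S ^ m)⁻¹ = S ^ m := fun m => by rw [← inv_pow, hS]
  have hmono : ∀ {m m'}, m ≤ m' → S ^ m ⊆ S ^ m' := fun h => Finset.pow_subset_pow_right hS1 h
  set Λ : Finset K := X.image fun x => ((a x₀)⁻¹ * a x : Kˣ) with hΛ
  have hXΛ : (X.card : ℝ) ≤ ℓ * Λ.card := by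
    rw [hΛ, Finset.card_eq_sum_card_image (fun x => (((a x₀)⁻¹ * a x : Kˣ) : K)) X, Nat.cast_sum,
      mul_comm, ← nsmul_eq_mul]
    refine Finset.sum_le_card_nsmul _ _ _ fun b hb => ?_
    obtain ⟨x, hx, rfl⟩ := Finset.mem_image.1 hb
    refine le_trans (Nat.cast_le.2 (Finset.card_le_card ?_)) (hscale (a x))
    intro y hy
    obtain ⟨hy, hxy⟩ := Finset.mem_filter.1 hy
    exact Finset.mem_filter.2 ⟨hy, mul_left_cancel (Units.ext hxy)⟩
  have hΛ2 : 2 ≤ Λ.card := by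
    by_contra! hlt
    have h1 : (Λ.card : ℝ) ≤ ((1 : ℕ) : ℝ) := Nat.cast_le.2 (by omega)
    rw [Nat.cast_one] at h1
    nlinarith
  let D : ℕ → Set K := fun m => {s | (⟨1, s • τ⟩ : ScaleShift K V) ∈ S ^ m}
  have hD1 : (1 : K) ∈ D 8 := by
    change (⟨1, (1 : K) • τ⟩ : ScaleShift K V) ∈ S ^ 8
    rwa [one_smul]
  have hDadd : ∀ {m m' s s'}, s ∈ D m → s' ∈ D m' → s + s' ∈ D (m + m') := by
    intro m m' s s' hs hs'
    have := Finset.mul_mem_mul hs' hs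
    rw [← pow_add, add_comm] at this
    change (⟨1, (s + s') • τ⟩ : ScaleShift K V) ∈ S ^ (m + m')
    convert this using 1
    ext1
    · simp
    · simp [add_smul]
  have hDneg : ∀ {m s}, s ∈ D m → -s ∈ D m := by
    intro m s hs
    have := Finset.inv_mem_inv hs
    rw [hinv] at this
    change (⟨1, -s • τ⟩ : ScaleShift K V) ∈ S ^ m
    convert this using 1
    ext1
    · simp
    · simp
  have hDΛ : ∀ {m s b}, b ∈ Λ → s ∈ D m → b * s ∈ D (m + 4) := by
    intro m s b hb hs
    obtain ⟨x, hx, rfl⟩ := Finset.mem_image.1 hb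
    have h1 := hX x₀ hx₀ x hx
    have h2 := Finset.inv_mem_inv h1
    rw [hinv] at h2
    have h3 := Finset.mul_mem_mul (Finset.mul_mem_mul h1 hs) h2
    rw [← pow_add, ← pow_add] at h3
    have h4 : 2 + m + 2 = m + 4 := by omega
    rw [h4] at h3
    change (⟨1, (((a x₀)⁻¹ * a x : Kˣ) * s : K) • τ⟩ : ScaleShift K V) ∈ S ^ (m + 4)
    convert h3 using 1
    ext1
    · simp
    · simp [smul_smul, Units.smul_def, mul_assoc]
      abel
  let E : ℕ → Set K := fun k => {s | 0 < k ∧ ∀ m, 0 < m → ∀ d ∈ D m, s * d ∈ D (k * m)}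
  obtain ⟨T, hT, hTE⟩ := exists_finset_card_pow E
    (by
      rintro k k' x y ⟨hk, hx⟩ ⟨hk', hy⟩
      refine ⟨by omega, fun m hm d hd => ?_⟩
      rw [add_mul, add_mul]
      exact hDadd (hx m hm d hd) (hy m hm d hd))
    (by
      rintro k x ⟨hk, hx⟩
      refine ⟨hk, fun m hm d hd => ?_⟩
      rw [neg_mul]
      exact hDneg (hx m hm d hd))
    (by
      rintro k k' x y ⟨hk, hx⟩ ⟨hk', hy⟩
      refine ⟨Nat.mul_pos hk hk', fun m hm d hd => ?_⟩
      rw [mul_assoc, mul_assoc]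
      exact hx _ (Nat.mul_pos hk' hm) _ (hy m hm d hd))
    Λ hΛ2 5
    (by
      intro b hb
      refine ⟨by norm_num, fun m hm d hd => ?_⟩
      exact hmono (by omega) (hDΛ hb hd))
    t fun j hj hj' => hchar j hj (hj'.trans (Nat.pow_le_pow_left Finset.card_image_le _))
  have hTS : T.card ≤ (S ^ (growthIndex 5 t * 8)).card := by
    refine Finset.card_le_card_of_injOn (fun s => (⟨1, s • τ⟩ : ScaleShift K V)) ?_ ?_
    · intro s hs
      have := (hTE hs).2 8 (by norm_num) 1 hD1
      rw [mul_one] at this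
      exact this
    · intro s _ s' _ h
      have h := congrArg ScaleShift.shift h
      exact smul_left_injective K hτ0 h
  calc (X.card : ℝ) ^ 2 ^ t ≤ (ℓ * Λ.card) ^ 2 ^ t := by gcongr
    _ = ℓ ^ 2 ^ t * (T.card : ℝ) := by rw [mul_pow, hT, Nat.cast_pow]
    _ ≤ _ := mul_le_mul_of_nonneg_left (Nat.cast_le.2 hTS) (by positivity)

open Classical in
open scoped Pointwise in
theorem exists_incidences_le (ε : ℝ) (hε : 0 < ε) : ∃ (N : ℕ) (δ C : ℝ), 0 < N ∧ 0 < δ ∧ 1 ≤ C ∧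
    ∀ (K : Type*) (V : Type*) (α : Type*) [Field K] [AddCommGroup V] [Module K V] [Fintype α]
      (a : α → Kˣ) (c : α → V) (U U' : Finset V) (n : ℝ), (Fintype.card α : ℝ) = n → C ≤ n →
      (U.card : ℝ) ≤ n → (U'.card : ℝ) ≤ n →
      (∀ j : ℕ, 0 < j → j ≤ Fintype.card α ^ N → (j : K) ≠ 0) →
      (∀ b : Kˣ, ((Finset.univ.filter fun x => a x = b).card : ℝ) ≤ n ^ (1 - ε)) →
      (∀ u v : V, ((Finset.univ.filter fun x => c x = v + (a x : K) • u).card : ℝ) ≤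
        n ^ (1 - ε)) →
      (incidences (fun x => (⟨-a x, c x⟩ : ScaleShift K V)) U U' : ℝ) ≤ n ^ (2 - δ) := by
  obtain ⟨t, ht⟩ : ∃ t : ℕ, 7 / ε < 2 ^ t := pow_unbounded_of_one_lt _ (by norm_num)
  have ht : 7 ≤ ε * 2 ^ t := by
    rw [div_lt_iff₀ hε] at ht
    linarith
  obtain ⟨i, hi⟩ : ∃ i, i = growthIndex 5 t * 8 := ⟨_, rfl⟩
  obtain ⟨P, hP⟩ : ∃ P, P = 226 * (2 ^ t + i + 1) := ⟨_, rfl⟩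
  obtain ⟨J, hJ⟩ : ∃ J, J = 5 * P := ⟨_, rfl⟩
  have hP3 : 3 ≤ P := by
    rw [hP]
    exact le_trans (by norm_num) (Nat.le_mul_of_pos_right 226 (Nat.succ_pos (2 ^ t + i)))
  have hP0 : (P : ℝ) ≠ 0 := Nat.cast_ne_zero.2 (by omega)
  refine ⟨4 * 2 ^ t, 1 / (2 * 2 ^ J : ℕ), 2 ^ P, by positivity, by positivity,
    one_le_pow₀ (by norm_num), ?_⟩
  intro K V α _ _ _ _ a c U U' n hn hCn hU hU' hchar hscale hline
  have hn8 : 8 ≤ n := by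
    refine le_trans ?_ hCn
    calc (8 : ℝ) = 2 ^ 3 := by norm_num
      _ ≤ 2 ^ P := pow_le_pow_right₀ (by norm_num) hP3
  have hn0 : 0 < n := by linarith
  have hn1 : 1 ≤ n := by linarith
  by_contra! hI
  set k : ℝ := n ^ (1 / (P : ℝ)) with hk
  set L : ℝ := n ^ (1 / ((2 * 2 ^ J : ℕ) : ℝ)) with hL
  set ℓ : ℝ := n ^ (1 - ε) with hℓ
  have hkP : k ^ P = n := by
    rw [hk, ← Real.rpow_natCast, ← Real.rpow_mul hn0.le, one_div_mul_cancel hP0, Real.rpow_one]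
  have hk2 : 2 ≤ k := by
    by_contra! hlt
    have : k ^ P < 2 ^ P := pow_lt_pow_left₀ hlt (by positivity) (by omega)
    rw [hkP] at this
    linarith
  have hk1 : 1 ≤ k := by linarith
  have hLJ : (L ^ 2 ^ J) ^ 2 = n := by
    rw [← pow_mul, mul_comm (2 ^ J) 2, hL, ← Real.rpow_natCast, ← Real.rpow_mul hn0.le,
      one_div_mul_cancel (Nat.cast_ne_zero.2 (by positivity)), Real.rpow_one]
  have hL1 : 1 ≤ L := Real.one_le_rpow hn1 (by positivity)
  have hM1 : 1 ≤ L ^ 2 ^ J := one_le_pow₀ hL1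
  have hℓ0 : 0 < ℓ := Real.rpow_pos_of_pos hn0 _
  have hℓt : ℓ ^ 2 ^ t * n ^ 7 ≤ n ^ 2 ^ t := by
    rw [hℓ, ← Real.rpow_natCast, ← Real.rpow_mul hn0.le, ← Real.rpow_natCast n 7,
      ← Real.rpow_natCast n (2 ^ t), ← Real.rpow_add hn0]
    refine Real.rpow_le_rpow_of_exponent_le hn1 ?_
    push_cast
    linarith
  have hI' : n ^ 2 ≤ L * incidences (fun x => (⟨-a x, c x⟩ : ScaleShift K V)) U U' := by
    calc n ^ 2 = L * n ^ (2 - 1 / ((2 * 2 ^ J : ℕ) : ℝ)) := by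
          rw [hL, ← Real.rpow_add hn0, ← Real.rpow_natCast]
          congr 1
          push_cast
          ring
      _ ≤ _ := by gcongr
  obtain ⟨S, y, hS1, hS, hyS, hSm⟩ := exists_symmetric_set_of_incidences
    ScaleShift.eq_of_smul_eq_smul (fun x => (⟨-a x, c x⟩ : ScaleShift K V)) U U' n hn hU hU' J k L
    hk2 (by rw [hJ, mul_comm, pow_mul, hkP]) hL1 hI' (by nlinarith) (by
      have : (L ^ 2 ^ J) ^ 4 = n ^ 2 := by rw [← hLJ]; ring
      rw [this]
      nlinarith [sq_nonneg n])
  set X := Finset.univ.filter fun x => y⁻¹ * (⟨-a x, c x⟩ : ScaleShift K V) ∈ S with hXdef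
  have hX : ∀ x ∈ X, ∀ x' ∈ X,
      (⟨-a x, c x⟩ : ScaleShift K V)⁻¹ * ⟨-a x', c x'⟩ ∈ S ^ 2 := by
    intro x hx x' hx'
    have h1 := Finset.inv_mem_inv (Finset.mem_filter.1 hx).2
    rw [hS] at h1
    have h2 := Finset.mul_mem_mul h1 (Finset.mem_filter.1 hx').2
    rwa [mul_inv_rev, inv_inv, mul_assoc, mul_inv_cancel_left, ← sq] at h2
  have hcontra : ¬ n ^ 2 ^ t ≤ n ^ 6 * ℓ ^ 2 ^ t := by
    intro h
    have h1 : (ℓ ^ 2 ^ t * n ^ 6) * n ≤ (ℓ ^ 2 ^ t * n ^ 6) * 1 := by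
      calc (ℓ ^ 2 ^ t * n ^ 6) * n = ℓ ^ 2 ^ t * n ^ 7 := by ring
        _ ≤ n ^ 6 * ℓ ^ 2 ^ t := hℓt.trans h
        _ = _ := by ring
    have := le_of_mul_le_mul_left h1 (by positivity)
    linarith
  have hpow : n ^ 2 ^ t ≤ k ^ (226 * 2 ^ t) * (X.card : ℝ) ^ 2 ^ t := by
    rw [pow_mul, ← mul_pow]
    gcongr
  have hXℓ : ℓ < X.card := by
    by_contra! hle
    refine hcontra (hpow.trans ?_)
    calc k ^ (226 * 2 ^ t) * (X.card : ℝ) ^ 2 ^ t ≤ k ^ P * ℓ ^ 2 ^ t := by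
          gcongr
          omega
      _ = n * ℓ ^ 2 ^ t := by rw [hkP]
      _ ≤ n ^ 6 * ℓ ^ 2 ^ t := by
        gcongr
        exact le_self_pow₀ hn1 (by norm_num)
  have hXS := card_pow_le_card_pow_mul a c X S hS1 hS hX ℓ hXℓ hℓ0.le
    (fun b => le_trans (Nat.cast_le.2 (Finset.card_le_card
      (Finset.filter_subset_filter _ (Finset.subset_univ _)))) (hscale b))
    (fun u v => le_trans (Nat.cast_le.2 (Finset.card_le_card
      (Finset.filter_subset_filter _ (Finset.subset_univ _)))) (hline u v)) t
    (fun j hj hj' => hchar j hj (hj'.trans (Nat.pow_le_pow_left (Finset.card_le_univ X) _)))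
  refine hcontra (hpow.trans ?_)
  calc k ^ (226 * 2 ^ t) * (X.card : ℝ) ^ 2 ^ t
      ≤ k ^ (226 * 2 ^ t) * (ℓ ^ 2 ^ t * (k ^ (226 * (i + 1)) * n ^ 5)) := by
        have := hSm i
        gcongr
        refine hXS.trans ?_
        rw [← hi]
        gcongr
    _ = k ^ P * n ^ 5 * ℓ ^ 2 ^ t := by
      have : P = 226 * 2 ^ t + 226 * (i + 1) := by rw [hP]; ring
      rw [this, pow_add]
      ring
    _ = n ^ 6 * ℓ ^ 2 ^ t := by rw [hkP]; ring

theorem exists_ker_eq_of_finrank_eq_three {K : Type*} [Field K] (W : Submodule K (Fin 4 → K))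
    (hW : finrank K W = 3) : ∃ φ : (Fin 4 → K) →ₗ[K] K, LinearMap.ker φ = W := by
  have h := W.finrank_quotient_add_finrank
  rw [hW, finrank_fin_fun] at h
  have h1 : finrank K ((Fin 4 → K) ⧸ W) = finrank K K := by rw [finrank_self]; omega
  refine ⟨(LinearEquiv.ofFinrankEq _ _ h1).toLinearMap ∘ₗ W.mkQ, ?_⟩
  rw [LinearEquiv.ker_comp, Submodule.ker_mkQ]

theorem exists_mem_apply_eq_one {K E : Type*} [Field K] [AddCommGroup E] [Module K E]
    (W : Submodule K E) (φ : E →ₗ[K] K) (h : ¬W ≤ LinearMap.ker φ) : ∃ e ∈ W, φ e = 1 := by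
  obtain ⟨e, he, h1⟩ := Set.not_subset.1 h
  have h2 : φ e ≠ 0 := h1
  exact ⟨(φ e)⁻¹ • e, W.smul_mem _ he, by rw [map_smul, smul_eq_mul, inv_mul_cancel₀ h2]⟩

theorem finrank_ker_eq_three {K : Type*} [Field K] (φ : (Fin 4 → K) →ₗ[K] K) (e : Fin 4 → K)
    (he : φ e = 1) : finrank K (LinearMap.ker φ) = 3 := by
  have h := φ.finrank_range_add_finrank_ker
  have h1 : LinearMap.range φ = ⊤ := by
    refine LinearMap.range_eq_top.2 fun b => ⟨b • e, ?_⟩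
    rw [map_smul, he, smul_eq_mul, mul_one]
  rw [h1, finrank_top, finrank_self, finrank_fin_fun] at h
  omega

theorem finrank_inf_eq_two {K : Type*} [Field K] (A B : Submodule K (Fin 4 → K))
    (hA : finrank K A = 3) (hB : finrank K B = 3) (hAB : ¬B ≤ A) :
    finrank K ↥(A ⊓ B) = 2 := by
  have h := Submodule.finrank_sup_add_finrank_inf_eq A B
  have h1 : finrank K A < finrank K ↥(A ⊔ B) :=
    Submodule.finrank_lt_finrank_of_lt (left_lt_sup.2 hAB)
  have h2 := Submodule.finrank_le (A ⊔ B)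
  rw [finrank_fin_fun] at h2
  omega

theorem exists_le_finrank_eq_two {K : Type*} [Field K] (W : Submodule K (Fin 4 → K))
    (hW : finrank K W ≤ 2) : ∃ W', W ≤ W' ∧ finrank K W' = 2 := by
  have key : ∀ k (W : Submodule K (Fin 4 → K)), finrank K W + k = 2 →
      ∃ W', W ≤ W' ∧ finrank K W' = 2 := by
    intro k
    induction k with
    | zero => exact fun W h => ⟨W, le_rfl, h⟩
    | succ k ih =>
      intro W h
      have h1 : W ≠ ⊤ := by
        rintro rfl
        rw [finrank_top, finrank_fin_fun] at h
        omega
      obtain ⟨w, -, hw⟩ := SetLike.exists_of_lt h1.lt_top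
      have h2 : W < W ⊔ K ∙ w :=
        left_lt_sup.2 fun h => hw (h (Submodule.mem_span_singleton_self w))
      have h3 := Submodule.finrank_lt_finrank_of_lt h2
      have h4 := Submodule.finrank_add_le_finrank_add_finrank W (K ∙ w)
      have h5 := finrank_span_singleton (K := K) (v := w) (by rintro rfl; exact hw W.zero_mem)
      obtain ⟨W', h6, h7⟩ := ih (W ⊔ K ∙ w) (by omega)
      exact ⟨W', h2.le.trans h6, h7⟩
  exact key (2 - finrank K W) W (by omega)

/-- The representative of `x` on which `φ` takes the value `1`, when `φ` does not vanish at `x`. -/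
noncomputable def normRep {K E : Type*} [Field K] [AddCommGroup E] [Module K E] (φ : E →ₗ[K] K)
    (x : Projectivization K E) : E := (φ x.rep)⁻¹ • x.rep

theorem apply_rep_eq_zero_iff {K E : Type*} [Field K] [AddCommGroup E] [Module K E]
    (φ : E →ₗ[K] K) (x : Projectivization K E) :
    φ x.rep = 0 ↔ x.submodule ≤ LinearMap.ker φ := by
  rw [x.submodule_eq, Submodule.span_singleton_le_iff_mem, LinearMap.mem_ker]

theorem eq_of_normRep_eq {K E : Type*} [Field K] [AddCommGroup E] [Module K E] (φ : E →ₗ[K] K)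
    {x y : Projectivization K E} (hx : φ x.rep ≠ 0)
    (h : normRep φ x = normRep φ y) : x = y := by
  rw [← x.mk_rep, ← y.mk_rep, Projectivization.mk_eq_mk_iff']
  refine ⟨φ x.rep * (φ y.rep)⁻¹, ?_⟩
  rw [mul_smul]
  change φ x.rep • normRep φ y = _
  rw [← h, normRep, smul_inv_smul₀ hx]

theorem submodule_le_of_normRep_mem {K E : Type*} [Field K] [AddCommGroup E] [Module K E]
    (φ : E →ₗ[K] K) {x : Projectivization K E} (hx : φ x.rep ≠ 0) {W : Submodule K E}
    (h : normRep φ x ∈ W) : x.submodule ≤ W := by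
  rw [x.submodule_eq, Submodule.span_singleton_le_iff_mem]
  exact (W.smul_mem_iff (inv_ne_zero hx)).1 h

theorem exists_rep_eq_of_coll3 {K : Type u} [Field K] {x y z : Projectivization K (Fin 4 → K)}
    (hxy : x ≠ y) (h : Coll3 x y z) : ∃ α β : K, z.rep = α • x.rep + β • y.rep := by
  have h1 : 2 ≤ finrank K ↥(x.submodule ⊔ y.submodule) := by
    by_contra! h2
    have hx : x.submodule = x.submodule ⊔ y.submodule :=
      Submodule.eq_of_le_of_finrank_le le_sup_left (by rw [x.finrank_submodule]; omega)
    have hy : y.submodule = x.submodule ⊔ y.submodule :=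
      Submodule.eq_of_le_of_finrank_le le_sup_right (by rw [y.finrank_submodule]; omega)
    exact hxy (Projectivization.submodule_injective (hx.trans hy.symm))
  have h2 : x.submodule ⊔ y.submodule = x.submodule ⊔ y.submodule ⊔ z.submodule :=
    Submodule.eq_of_le_of_finrank_le le_sup_left (le_trans h h1)
  have h3 : z.rep ∈ x.submodule ⊔ y.submodule := by
    rw [h2]
    refine Submodule.mem_sup_right ?_
    rw [z.submodule_eq]
    exact Submodule.mem_span_singleton_self _
  rw [x.submodule_eq, y.submodule_eq, Submodule.mem_sup] at h3
  obtain ⟨_, hp, _, hq, hz⟩ := h3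
  obtain ⟨α, rfl⟩ := Submodule.mem_span_singleton.1 hp
  obtain ⟨β, rfl⟩ := Submodule.mem_span_singleton.1 hq
  exact ⟨α, β, hz.symm⟩

theorem normRep_eq_of_coll3 {K : Type u} [Field K] {φ₁ φ₂ : (Fin 4 → K) →ₗ[K] K}
    {x y z : Projectivization K (Fin 4 → K)} (hxy : x ≠ y) (h : Coll3 x y z)
    (hx : φ₁ x.rep = 0) (hy : φ₂ y.rep = 0) (hz₁ : φ₁ z.rep ≠ 0) (hz₂ : φ₂ z.rep ≠ 0) :
    φ₂ x.rep ≠ 0 ∧ φ₁ y.rep ≠ 0 ∧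
      normRep φ₁ z = φ₂ (normRep φ₁ z) • normRep φ₂ x + normRep φ₁ y := by
  obtain ⟨α, β, hr⟩ := exists_rep_eq_of_coll3 hxy h
  have h1 : φ₁ z.rep = β * φ₁ y.rep := by
    rw [hr, map_add, map_smul, map_smul, hx, smul_zero, zero_add, smul_eq_mul]
  have h2 : φ₂ z.rep = α * φ₂ x.rep := by
    rw [hr, map_add, map_smul, map_smul, hy, smul_zero, add_zero, smul_eq_mul]
  rw [h1] at hz₁
  rw [h2] at hz₂
  have hβ := left_ne_zero_of_mul hz₁
  have hy' := right_ne_zero_of_mul hz₁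
  have hx' := right_ne_zero_of_mul hz₂
  refine ⟨hx', hy', ?_⟩
  simp only [normRep, map_smul, h1, h2, smul_eq_mul]
  rw [hr, smul_add, smul_smul, smul_smul, smul_smul]
  congr 2 <;> field_simp

theorem card_filter_subtype_le_ncard {α : Type*} (s : Finset α) (p : s → Prop) [DecidablePred p]
    (q : α → Prop)
    (h : ∀ x : s, p x → q x) :
    (Finset.univ.filter p).card ≤ {x | x ∈ s ∧ q x}.ncard := by
  rw [← Set.ncard_coe_finset]
  refine Set.ncard_le_ncard_of_injOn Subtype.val ?_ Subtype.val_injective.injOn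
    (s.finite_toSet.subset fun x hx => hx.1)
  intro x hx
  exact ⟨x.2, h x (by simpa using hx)⟩

theorem natCast_ne_zero_of_lt_ringChar_rpow {K : Type*} [Field K] {m N : ℕ} (hN : 0 < N)
    (h : ∀ p : ℕ, ringChar K = p → 0 < p → (m : ℝ) < (p : ℝ) ^ ((1 : ℝ) / N)) {j : ℕ}
    (hj : 0 < j) (hjm : j ≤ m ^ N) : (j : K) ≠ 0 := by
  intro h0
  have h1 := (ringChar.spec K j).1 h0
  have hp : 0 < ringChar K := Nat.pos_of_dvd_of_pos h1 hj
  have h2 := h _ rfl hp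
  have h3 : ((m ^ N : ℕ) : ℝ) < ringChar K := by
    have h4 := pow_lt_pow_left₀ h2 (Nat.cast_nonneg m) hN.ne'
    rwa [one_div, Real.rpow_inv_natCast_pow (Nat.cast_nonneg _) hN.ne', ← Nat.cast_pow] at h4
  have h5 := Nat.cast_lt.1 h3
  have h6 := Nat.le_of_dvd hj h1
  omega

/-- Quantitative orchard bound for three planes: for every `ε > 0` there
are `N ∈ ℕ`, `δ > 0` and `C ≥ 1` such that over any field `K`, for distinct projective
planes `P₁, P₂ ⊆ ℙ³(K)`, finite sets `X₁ ⊆ P₁`, `X₂ ⊆ P₂`, `X₃ ⊆ ℙ³(K)∖(P₁∪P₂)` of the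
same size `≥ C`, with `|X₁| < p^{1/N}` in characteristic `p > 0`, with `X₃` not
concentrating on planes meeting `P₁` and `P₂` in a common line, and with no `Xᵢ`
concentrating on projective lines, the number of collinear triples in `X₁ × X₂ × X₃` is at
most `|X₁|^{2−δ}`. -/
theorem three_planes_orchard :
    ∀ ε : ℝ, 0 < ε → ∃ (N : ℕ) (δ C : ℝ), 0 < N ∧ 0 < δ ∧ 1 ≤ C ∧
      ∀ (K : Type u) [Field K],
      ∀ W₁ W₂ : Submodule K (Fin 4 → K), finrank K W₁ = 3 → finrank K W₂ = 3 → W₁ ≠ W₂ →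
      ∀ X₁ X₂ X₃ : Finset (Projectivization K (Fin 4 → K)),
        -- `X₁ ⊆ P₁`, `X₂ ⊆ P₂`, `X₃ ⊆ ℙ³(K) ∖ (P₁ ∪ P₂)`
        (∀ x ∈ X₁, x.submodule ≤ W₁) →
        (∀ x ∈ X₂, x.submodule ≤ W₂) →
        (∀ x ∈ X₃, ¬x.submodule ≤ W₁ ∧ ¬x.submodule ≤ W₂) →
        -- (1) `|X₁| = |X₂| = |X₃| ≥ C`
        X₁.card = X₂.card → X₁.card = X₃.card → C ≤ (X₁.card : ℝ) →
        -- (2) `|X₁| < p^{1/N}` if `char K = p > 0`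
        (∀ p : ℕ, ringChar K = p → 0 < p → (X₁.card : ℝ) < (p : ℝ) ^ ((1 : ℝ) / N)) →
        -- (3) `X₃` does not concentrate on planes meeting `P₁`, `P₂` in a common line
        (∀ W : Submodule K (Fin 4 → K), finrank K W = 3 →
          W ⊓ W₁ = W ⊓ W₂ → finrank K ↥(W ⊓ W₁) = 2 →
          (({x : Projectivization K (Fin 4 → K) | x ∈ X₃ ∧ x.submodule ≤ W}.ncard : ℝ) ≤
            (X₃.card : ℝ) ^ ((1 : ℝ) - ε))) →
        -- (4) no `Xᵢ` concentrates on a projective line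
        (∀ W : Submodule K (Fin 4 → K), finrank K W = 2 →
          (({x : Projectivization K (Fin 4 → K) | x ∈ X₁ ∧ x.submodule ≤ W}.ncard : ℝ) ≤
              (X₁.card : ℝ) ^ ((1 : ℝ) - ε) ∧
            ({x : Projectivization K (Fin 4 → K) | x ∈ X₂ ∧ x.submodule ≤ W}.ncard : ℝ) ≤
              (X₂.card : ℝ) ^ ((1 : ℝ) - ε) ∧
            ({x : Projectivization K (Fin 4 → K) | x ∈ X₃ ∧ x.submodule ≤ W}.ncard : ℝ) ≤
              (X₃.card : ℝ) ^ ((1 : ℝ) - ε))) →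
        (({t : Projectivization K (Fin 4 → K) × Projectivization K (Fin 4 → K) ×
              Projectivization K (Fin 4 → K) |
            t.1 ∈ X₁ ∧ t.2.1 ∈ X₂ ∧ t.2.2 ∈ X₃ ∧
              t.1 ≠ t.2.1 ∧ t.1 ≠ t.2.2 ∧ t.2.1 ≠ t.2.2 ∧
              Coll3 t.1 t.2.1 t.2.2}.ncard : ℝ) ≤
          (X₁.card : ℝ) ^ ((2 : ℝ) - δ)) := by
  intro ε hε
  obtain ⟨N, δ, C, hN, hδ, hC, main⟩ := exists_incidences_le ε hε
  refine ⟨N, δ, C, hN, hδ, hC, ?_⟩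
  intro K _ W₁ W₂ hW₁ hW₂ hne X₁ X₂ X₃ hX₁ hX₂ hX₃ h12 h13 hCX hchar hplane hline
  classical
  obtain ⟨φ₁, rfl⟩ := exists_ker_eq_of_finrank_eq_three W₁ hW₁
  obtain ⟨φ₂, rfl⟩ := exists_ker_eq_of_finrank_eq_three W₂ hW₂
  obtain ⟨e₁, he₁, he₁'⟩ := exists_mem_apply_eq_one (LinearMap.ker φ₁) φ₂ fun h =>
    hne (Submodule.eq_of_le_of_finrank_le h (by rw [hW₁, hW₂]))
  obtain ⟨e₂, he₂, he₂'⟩ := exists_mem_apply_eq_one (LinearMap.ker φ₂) φ₁ fun h =>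
    hne (Submodule.eq_of_le_of_finrank_le h (by rw [hW₁, hW₂])).symm
  rw [LinearMap.mem_ker] at he₁ he₂
  simp only [← apply_rep_eq_zero_iff] at hX₁ hX₂ hX₃
  have ha : ∀ x : X₃, φ₂ (normRep φ₁ x.1) ≠ 0 := fun x => by
    rw [normRep, map_smul, smul_eq_mul]
    exact mul_ne_zero (inv_ne_zero (hX₃ x x.2).1) (hX₃ x x.2).2
  have hφ₁ : ∀ x : X₃, φ₁ (normRep φ₁ x.1) = 1 := fun x => by
    rw [normRep, map_smul, smul_eq_mul, inv_mul_cancel₀ (hX₃ x x.2).1]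
  have key := main K (Fin 4 → K) X₃ (fun x => Units.mk0 _ (ha x))
    (fun x => normRep φ₁ x.1 - e₂ - φ₂ (normRep φ₁ x.1) • e₁)
    (X₁.image fun x => normRep φ₂ x - e₁) (X₂.image fun x => normRep φ₁ x - e₂) X₁.card
    (by rw [Fintype.card_coe, h13]) hCX (Nat.cast_le.2 Finset.card_image_le)
    (by rw [h12]; exact Nat.cast_le.2 Finset.card_image_le)
    (fun j hj hjN => natCast_ne_zero_of_lt_ringChar_rpow hN hchar hj
      (by rwa [Fintype.card_coe, ← h13] at hjN)) ?_ ?_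
  · refine le_trans (Nat.cast_le.2 ?_) key
    rw [incidences, ← Set.ncard_coe_finset]
    have hcoll : ∀ t : Projectivization K (Fin 4 → K) × Projectivization K (Fin 4 → K) ×
        Projectivization K (Fin 4 → K), t.1 ∈ X₁ ∧ t.2.1 ∈ X₂ ∧ t.2.2 ∈ X₃ ∧
          t.1 ≠ t.2.1 ∧ t.1 ≠ t.2.2 ∧ t.2.1 ≠ t.2.2 ∧ Coll3 t.1 t.2.1 t.2.2 →
        φ₂ t.1.rep ≠ 0 ∧ φ₁ t.2.1.rep ≠ 0 ∧ normRep φ₁ t.2.2 =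
          φ₂ (normRep φ₁ t.2.2) • normRep φ₂ t.1 + normRep φ₁ t.2.1 := by
      rintro t ⟨h1, h2, h3, h4, -, -, h5⟩
      exact normRep_eq_of_coll3 h4 h5 (hX₁ _ h1) (hX₂ _ h2) (hX₃ _ h3).1 (hX₃ _ h3).2
    refine Set.ncard_le_ncard_of_injOn
      (fun t => (if h : t.2.2 ∈ X₃ then ⟨t.2.2, h⟩ else Classical.choice ?_, normRep φ₂ t.1 - e₁))
      ?_ ?_ (Finset.finite_toSet _)
    · have : 0 < X₃.card := by
        rw [← h13]
        exact Nat.cast_pos.1 (one_pos.trans_le (hC.trans hCX))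
      exact (Finset.card_pos.1 this).to_subtype
    · intro t ht
      obtain ⟨-, -, h6⟩ := hcoll t ht
      obtain ⟨h1, h2, h3, -⟩ := ht
      simp only [dif_pos h3, Finset.coe_filter, Finset.mem_product, Finset.mem_univ, true_and,
        Set.mem_ofPred_eq]
      refine ⟨Finset.mem_image_of_mem _ h1, ?_⟩
      refine Finset.mem_image.2 ⟨t.2.1, h2, ?_⟩
      rw [ScaleShift.smul_def, Units.smul_def, Units.val_neg, Units.val_mk0]
      linear_combination (norm := module) -h6
    · intro s hs t ht hst
      obtain ⟨s1, s2, s3⟩ := hcoll s hs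
      obtain ⟨-, -, t3⟩ := hcoll t ht
      simp only [dif_pos hs.2.2.1, dif_pos ht.2.2.1, Prod.mk.injEq, Subtype.mk.injEq,
        sub_left_inj] at hst
      have h1 := eq_of_normRep_eq φ₂ s1 hst.2
      rw [hst.1, hst.2] at s3
      have h2 := eq_of_normRep_eq φ₁ s2 (add_left_cancel (s3.symm.trans t3))
      exact Prod.ext h1 (Prod.ext h2 hst.1)
  · intro b
    have hb : (φ₂ - (b : K) • φ₁) e₁ = 1 := by
      rw [LinearMap.sub_apply, LinearMap.smul_apply, he₁, he₁', smul_zero, sub_zero]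
    have hW := finrank_ker_eq_three _ e₁ hb
    have h1 := hplane _ hW
      (by
        ext w
        simp only [Submodule.mem_inf, LinearMap.mem_ker, LinearMap.sub_apply,
          LinearMap.smul_apply, smul_eq_mul]
        constructor
        · rintro ⟨h1, h2⟩
          rw [h2, mul_zero, sub_zero] at h1
          exact ⟨by rw [h1, h2, mul_zero, sub_zero], h1⟩
        · rintro ⟨h1, h2⟩
          rw [h2, zero_sub, neg_eq_zero] at h1
          exact ⟨by rw [h1, h2, sub_zero], (mul_eq_zero.1 h1).resolve_left b.ne_zero⟩)
      (finrank_inf_eq_two _ _ hW hW₁ fun h => by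
        have : (φ₂ - (b : K) • φ₁) e₁ = 0 := h he₁
        exact one_ne_zero (hb.symm.trans this))
    rw [h13]
    refine le_trans (Nat.cast_le.2 (card_filter_subtype_le_ncard X₃ _ _ fun x hx => ?_)) h1
    refine submodule_le_of_normRep_mem φ₁ (hX₃ x x.2).1 ?_
    have h2 : φ₂ (normRep φ₁ x.1) = b := congrArg Units.val hx
    rw [LinearMap.mem_ker, LinearMap.sub_apply, LinearMap.smul_apply, h2, hφ₁, smul_eq_mul,
      mul_one, sub_self]
  · intro u v
    obtain ⟨W, hW, hW2⟩ := exists_le_finrank_eq_two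
      (Submodule.span K (({e₁ + u, e₂ + v} : Finset (Fin 4 → K)) : Set (Fin 4 → K)))
      ((finrank_span_finset_le_card {e₁ + u, e₂ + v}).trans Finset.card_le_two)
    have h2 : ∀ x : X₃, normRep φ₁ x.1 - e₂ - φ₂ (normRep φ₁ x.1) • e₁ =
        v + φ₂ (normRep φ₁ x.1) • u → x.1.submodule ≤ W := by
      intro x hx
      refine submodule_le_of_normRep_mem φ₁ (hX₃ x x.2).1 (hW ?_)
      rw [Finset.coe_pair]
      refine Submodule.mem_span_pair.2 ⟨φ₂ (normRep φ₁ x.1), 1, ?_⟩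
      linear_combination (norm := module) -hx
    rw [h13]
    refine le_trans (Nat.cast_le.2 ?_) (hline W hW2).2.2
    convert card_filter_subtype_le_ncard X₃ _ (fun x => x.submodule ≤ W) h2
    rfl
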